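/- Let B₊ = {(x', x'') ∈ ℝ^{d-1} × ℝ : |x'|² + (x'')² < 1, x'' > 0} be the open unit half-ball and Γ = {(x', x'') ∈ closure(B₊) : x'' = 0} its flat boundary part. There exist γ ∈ (0,1) and C > 0 (depending only on d) such that: if h is harmonic in B₊, h is C¹ on the closure of B₊, |h| ≤ 1 and |∇h| ≤ 1 in B₊, and |h| ≤ ε and |∂_d h| ≤ ε on Γ for some ε ≤ 1, then |h(x)| ≤ C ε^γ for all x in the half-ball (1/3)B₊ = {(x', x'') : |x'|² + (x'')² < 1/9, x'' > 0}. -/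

import Mathlib

open Metric MeasureTheory Set
open scoped ENNReal NNReal

noncomputable section

/-- `Euc m` is the Euclidean space `ℝ^(m+1)`. -/
abbrev Euc (m : ℕ) : Type := EuclideanSpace ℝ (Fin (m + 1))

/-- The first `m` coordinates of a point of `ℝ^(m+1)`. -/
def front {m : ℕ} (y : Euc m) : EuclideanSpace ℝ (Fin m) :=
  (WithLp.equiv 2 (∀ _ : Fin m, ℝ)).symm fun i : Fin m => y i.castSucc

/-- The last coordinate of a point of `ℝ^(m+1)`. -/
def lastC {m : ℕ} (y : Euc m) : ℝ := y (Fin.last m)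

/-- The unit vector of `ℝ^(m+1)` in the last coordinate direction. -/
def eLast (m : ℕ) : Euc m := EuclideanSpace.single (Fin.last m) 1

/-- The point `(x', 0) ∈ ℝ^(m+1)` determined by `x' ∈ ℝ^m`. -/
def pad {m : ℕ} (x' : EuclideanSpace ℝ (Fin m)) : Euc m :=
  (WithLp.equiv 2 (∀ _ : Fin (m + 1), ℝ)).symm
    (Fin.snoc (WithLp.equiv 2 (∀ _ : Fin m, ℝ) x') 0)

/-- The Laplacian of `h : ℝ^d → ℝ` at `x`: the sum of the pure second derivatives in the
coordinate directions. -/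
def lap {d : ℕ} (h : EuclideanSpace ℝ (Fin d) → ℝ) (x : EuclideanSpace ℝ (Fin d)) : ℝ :=
  ∑ i : Fin d, iteratedFDeriv ℝ 2 h x ![EuclideanSpace.single i 1, EuclideanSpace.single i 1]

/-- `h` is harmonic on `Ω`: it is twice continuously differentiable there and its
Laplacian vanishes. -/
def IsHarmonicOn {d : ℕ} (h : EuclideanSpace ℝ (Fin d) → ℝ)
    (Ω : Set (EuclideanSpace ℝ (Fin d))) : Prop :=
  ContDiffOn ℝ 2 h Ω ∧ ∀ x ∈ Ω, lap h x = 0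

/-- `H_h(x,r) = ∫_{B(x,r) ∩ Ω} h²`. -/
def Hh {d : ℕ} (Ω : Set (EuclideanSpace ℝ (Fin d))) (h : EuclideanSpace ℝ (Fin d) → ℝ)
    (x : EuclideanSpace ℝ (Fin d)) (r : ℝ) : ℝ :=
  ∫ y in ball x r ∩ Ω, (h y) ^ 2

/-- The doubling index `N_h(x,r) = log (H_h(x,2r) / H_h(x,r))`. -/
def Nh {d : ℕ} (Ω : Set (EuclideanSpace ℝ (Fin d))) (h : EuclideanSpace ℝ (Fin d) → ℝ)
    (x : EuclideanSpace ℝ (Fin d)) (r : ℝ) : ℝ :=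
  Real.log (Hh Ω h x (2 * r) / Hh Ω h x r)

/-- `∂Ω ∩ B(x,r) ∈ Lip(τ)`: in suitable isometric coordinates centered at `x`, `Ω ∩ B(x,r)`
is the region above the graph of a `τ`-Lipschitz function `f` with `f 0 = 0`. -/
def LipGraph {m : ℕ} (Ω : Set (Euc m)) (τ : ℝ≥0) (x : Euc m) (r : ℝ) : Prop :=
  ∃ T : Euc m ≃ᵢ Euc m, ∃ f : EuclideanSpace ℝ (Fin m) → ℝ,
    T 0 = x ∧ LipschitzOnWith τ f (ball 0 r) ∧ f 0 = 0 ∧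
    Ω ∩ ball x r = T '' {y : Euc m | y ∈ ball (0 : Euc m) r ∧ f (front y) < lastC y}

/-- `∂Ω ∩ B(x,r)` is a `C^k`-smooth graph: same as `LipGraph` but with a `C^k` function. -/
def SmoothGraph {m : ℕ} (k : ℕ) (Ω : Set (Euc m)) (x : Euc m) (r : ℝ) : Prop :=
  ∃ T : Euc m ≃ᵢ Euc m, ∃ f : EuclideanSpace ℝ (Fin m) → ℝ,
    T 0 = x ∧ ContDiffOn ℝ k f (ball 0 r) ∧ f 0 = 0 ∧
    Ω ∩ ball x r = T '' {y : Euc m | y ∈ ball (0 : Euc m) r ∧ f (front y) < lastC y}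

/-- The closed axis-parallel cube with center `p` and side length `s`. -/
def cube {d : ℕ} (p : EuclideanSpace ℝ (Fin d)) (s : ℝ) : Set (EuclideanSpace ℝ (Fin d)) :=
  {y | ∀ i, |y i - p i| ≤ s / 2}

/-- The maximal doubling index `N*_h(Q)` of `h` in the cube `Q`. -/
def Nstar {d : ℕ} (Ω : Set (EuclideanSpace ℝ (Fin d))) (h : EuclideanSpace ℝ (Fin d) → ℝ)
    (Q : Set (EuclideanSpace ℝ (Fin d))) : ℝ :=
  sSup {N : ℝ | ∃ x ∈ Q ∩ closure Ω, ∃ r : ℝ,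
    Metric.diam Q / 2 ≤ r ∧ r ≤ Metric.diam Q ∧ N = Nh Ω h x r}

/-- Centers of the boundary cubes `q ∈ B_k(Q)` of the standard construction: `z` lies on
`∂Ω ∩ Q` and its horizontal projection is the center of one of the `2^(k·m)` congruent
subcubes of side `s/2^k` partitioning the projection of `Q`. -/
def bCenters {m : ℕ} (Ω : Set (Euc m)) (xQ : Euc m) (s : ℝ) (k : ℕ) : Set (Euc m) :=
  {z | z ∈ frontier Ω ∩ cube xQ s ∧
    ∃ j : Fin m → Fin (2 ^ k), ∀ i : Fin m,
      front z i = front xQ i - s / 2 + (s / 2 ^ k) * ((j i : ℝ) + 1 / 2)}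

/-- The open half-ball `{x : |x| < c, x'' > 0}` in `ℝ^(m+1)`. -/
def halfBall (m : ℕ) (c : ℝ) : Set (Euc m) := {y : Euc m | ‖y‖ < c ∧ 0 < lastC y}

/-- The flat part `Γ` of the boundary of the unit half-ball. -/
def flatPart (m : ℕ) : Set (Euc m) := {y ∈ closure (halfBall m 1) | lastC y = 0}

/-- The exponent produced by interpolating between the circles of radii `1/16` and `1/2`. -/
def interpExp : ℝ := 1 - Real.log (22 / 3) / Real.log 8

lemma interpExp_mem : interpExp ∈ Ioo (0 : ℝ) 1 := by
  have h8 : 0 < Real.log 8 := Real.log_pos (by norm_num)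
  have h0 : 0 < Real.log (22 / 3) := Real.log_pos (by norm_num)
  have h1 : Real.log (22 / 3) < Real.log 8 := Real.log_lt_log (by norm_num) (by norm_num)
  have h2 : Real.log (22 / 3) / Real.log 8 < 1 := (div_lt_one h8).2 h1
  have h3 : 0 < Real.log (22 / 3) / Real.log 8 := div_pos h0 h8
  constructor <;> unfold interpExp <;> linarith

/-- A three-circle theorem with explicit radii, deduced from the three-line theorem. -/
lemma norm_le_of_norm_le_on_circles {F : ℂ → ℂ} {C e r : ℝ}
    (hF : DifferentiableOn ℂ F (ball 0 (51 / 100))) (hC : 0 < C) (he0 : 0 < e) (he1 : e ≤ 1)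
    (h1 : ∀ z, ‖z‖ ≤ 1 / 2 → ‖F z‖ ≤ C) (h2 : ∀ z, ‖z‖ ≤ 1 / 16 → ‖F z‖ ≤ C * e)
    (hr : 1 / 16 ≤ r) (hr' : r ≤ 11 / 24) : ‖F r‖ ≤ C * e ^ interpExp := by
  have hr0 : 0 < r := by linarith
  have hul : Real.log (1 / 16) < Real.log (1 / 2) :=
    Real.log_lt_log (by norm_num) (by norm_num)
  have hsub : Real.log (1 / 2) - Real.log (1 / 16) = Real.log 8 := by
    rw [← Real.log_div (by norm_num) (by norm_num)]; norm_num
  have hnorm : ∀ w : ℂ, w.re ≤ Real.log (1 / 2) → ‖Complex.exp w‖ ≤ 1 / 2 := fun w hw => by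
    rw [Complex.norm_exp]
    exact (Real.exp_le_exp.2 hw).trans (Real.exp_log (by norm_num)).le
  have hd : DiffContOnCl ℂ (F ∘ Complex.exp)
      (Complex.HadamardThreeLines.verticalStrip (Real.log (1 / 16)) (Real.log (1 / 2))) := by
    apply DifferentiableOn.diffContOnCl
    refine hF.comp Complex.differentiable_exp.differentiableOn fun w hw => ?_
    rw [Complex.HadamardThreeLines.verticalStrip, Complex.closure_preimage_re,
      closure_Ioo hul.ne] at hw
    rw [mem_ball_zero_iff]
    linarith [hnorm w hw.2]
  have key := Complex.HadamardThreeLines.norm_le_interp_of_mem_verticalClosedStrip'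
    (f := F ∘ Complex.exp) (z := (Real.log r : ℂ)) (a := C * e) (b := C) hul ?_ hd ?_ ?_ ?_
  · have hexp : Complex.exp (Real.log r : ℂ) = r := by
      rw [← Complex.ofReal_exp, Real.exp_log hr0]
    simp only [Function.comp_apply, hexp, Complex.ofReal_re, hsub] at key
    have hlog : Real.log r - Real.log (1 / 16) = Real.log (16 * r) := by
      rw [← Real.log_div hr0.ne' (by norm_num)]; congr 1; ring
    rw [hlog] at key
    refine key.trans ?_
    rw [Real.mul_rpow hC.le he0.le, mul_right_comm, ← Real.rpow_add hC, sub_add_cancel,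
      Real.rpow_one]
    refine mul_le_mul_of_nonneg_left ?_ hC.le
    refine Real.rpow_le_rpow_of_exponent_ge he0 he1 ?_
    unfold interpExp
    have : Real.log (16 * r) ≤ Real.log (22 / 3) :=
      Real.log_le_log (by positivity) (by linarith)
    have h8 : 0 < Real.log 8 := Real.log_pos (by norm_num)
    gcongr
  · simp only [Complex.HadamardThreeLines.verticalClosedStrip, mem_preimage, Complex.ofReal_re]
    exact ⟨Real.log_le_log (by norm_num) hr, Real.log_le_log hr0 (by linarith)⟩
  · refine ⟨C, ?_⟩
    rintro _ ⟨w, hw, rfl⟩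
    exact h1 _ (hnorm w hw.2)
  · intro w hw
    refine h2 _ ?_
    rw [Complex.norm_exp, show w.re = _ from hw, Real.exp_log (by norm_num)]
  · intro w hw
    exact h1 _ (hnorm w (le_of_eq hw))

/-- Differentiation under the integral sign over a compact set, for a continuous integrand that
is holomorphic in the parameter. -/
lemma differentiableOn_setIntegral {α : Type*} [TopologicalSpace α] [T2Space α]
    [MeasurableSpace α] [OpensMeasurableSpace α] [SecondCountableTopology α]
    {μ : Measure α} [IsFiniteMeasureOnCompacts μ] {K : Set α}
    (hK : IsCompact K) {U : Set ℂ} (hU : IsOpen U) {G : ℂ → α → ℂ}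
    (hc : ContinuousOn (Function.uncurry G) (U ×ˢ K))
    (hd : ∀ y ∈ K, DifferentiableOn ℂ (fun z => G z y) U) :
    DifferentiableOn ℂ (fun z => ∫ y in K, G z y ∂μ) U := by
  have hcz : ∀ z ∈ U, ContinuousOn (G z) K := fun z hz =>
    hc.comp (f := fun y => (z, y)) (by fun_prop) fun y hy => ⟨hz, hy⟩
  intro z₀ hz₀
  obtain ⟨r, hr, hrU⟩ := Metric.nhds_basis_closedBall.mem_iff.1 (hU.mem_nhds hz₀)
  obtain ⟨M, hM⟩ := ((isCompact_closedBall z₀ r).prod hK).exists_bound_of_continuousOn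
    (hc.mono (prod_mono hrU le_rfl))
  have hmeas : ∀ z ∈ U, AEStronglyMeasurable (G z) (μ.restrict K) := fun z hz =>
    (hcz z hz).aestronglyMeasurable hK.measurableSet
  have hD : ∀ y ∈ K, ∀ z ∈ ball z₀ (r / 2),
      HasDerivAt (fun z => G z y) (deriv (fun z => G z y) z) z :=
    fun y hy z hz => ((hd y hy).differentiableAt (hU.mem_nhds
      (hrU (ball_subset_closedBall (ball_subset_ball (by linarith) hz))))).hasDerivAt
  have hs : ∀ n : ℕ, z₀ + ((r / 2 / (n + 1 : ℝ) : ℝ) : ℂ) ∈ closedBall z₀ r := fun n => by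
    rw [mem_closedBall, dist_eq_norm, add_sub_cancel_left, Complex.norm_real, Real.norm_of_nonneg
      (by positivity)]
    have : r / 2 / (n + 1 : ℝ) ≤ r / 2 := div_le_self (by positivity) (by norm_cast; omega)
    linarith
  have key := hasDerivAt_integral_of_dominated_loc_of_deriv_le (μ := μ.restrict K) (𝕜 := ℂ)
    (F := G) (F' := fun z y => deriv (fun z => G z y) z) (bound := fun _ => M / (r / 2))
    (ball_mem_nhds z₀ (half_pos hr)) ?_ ?_ ?_ ?_ ?_ ?_
  · exact key.2.differentiableAt.differentiableWithinAt
  · filter_upwards [hU.mem_nhds hz₀] with z hz using hmeas z hz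
  · exact (hcz z₀ hz₀).integrableOn_compact hK
  · refine aestronglyMeasurable_of_tendsto_ae (u := Filter.atTop)
      (f := fun (n : ℕ) y => (((r / 2 / (n + 1 : ℝ) : ℝ) : ℂ))⁻¹ •
        (G (z₀ + ((r / 2 / (n + 1 : ℝ) : ℝ) : ℂ)) y - G z₀ y)) ?_ ?_
    · intro n
      have := (hmeas _ (hrU (hs n))).sub (hmeas z₀ hz₀)
      exact this.const_smul (((r / 2 / (n + 1 : ℝ) : ℝ) : ℂ))⁻¹
    · refine (ae_restrict_iff' hK.measurableSet).2 (.of_forall fun y hy => ?_)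
      have := hasDerivAt_iff_tendsto_slope_zero.1 (hD y hy z₀ (mem_ball_self (half_pos hr)))
      refine this.comp (tendsto_nhdsWithin_iff.2 ⟨?_, .of_forall fun n => ?_⟩)
      · have h0 : Filter.Tendsto (fun n : ℕ => r / 2 / (n + 1 : ℝ)) Filter.atTop (nhds 0) := by
          have := (tendsto_one_div_add_atTop_nhds_zero_nat (𝕜 := ℝ)).const_mul (r / 2)
          simpa [div_eq_mul_inv] using this
        exact (Complex.continuous_ofReal.tendsto' 0 0 rfl).comp h0
      · have : (r / 2 / (n + 1 : ℝ) : ℝ) ≠ 0 := by positivity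
        exact Complex.ofReal_ne_zero.2 this
  · refine (ae_restrict_iff' hK.measurableSet).2 (.of_forall fun y hy z hz => ?_)
    have hsub : closedBall z (r / 2) ⊆ closedBall z₀ r := closedBall_subset_closedBall' (by
      have := mem_ball.1 hz; linarith)
    refine Complex.norm_deriv_le_of_forall_mem_sphere_norm_le (half_pos hr) ?_ ?_
    · refine DifferentiableOn.diffContOnCl ((hd y hy).mono ?_)
      exact (closure_ball_subset_closedBall.trans hsub).trans hrU
    · exact fun w hw => hM (w, y) ⟨hsub (sphere_subset_closedBall hw), hy⟩
  · exact integrableOn_const hK.measure_lt_top.ne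
  · exact (ae_restrict_iff' hK.measurableSet).2 (.of_forall hD)

/-- The squared Euclidean norm on `Fin n → ℝ`. -/
def sqNorm {n : ℕ} (y : Fin n → ℝ) : ℝ := ∑ i, y i ^ 2

lemma continuous_sqNorm {n : ℕ} : Continuous (sqNorm (n := n)) := by
  unfold sqNorm; fun_prop

lemma sq_le_sqNorm {n : ℕ} (y : Fin n → ℝ) (i : Fin n) : y i ^ 2 ≤ sqNorm y :=
  Finset.single_le_sum (f := fun i => y i ^ 2) (fun _ _ => sq_nonneg _) (Finset.mem_univ i)

lemma sqNorm_nonneg {n : ℕ} (y : Fin n → ℝ) : 0 ≤ sqNorm y :=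
  Finset.sum_nonneg fun _ _ => sq_nonneg _

/-- The closed half-ball of radius `3/5`. -/
def closedHalf (n : ℕ) : Set (Fin (n + 1) → ℝ) := {y | 0 ≤ y (Fin.last n) ∧ sqNorm y ≤ 9 / 25}

/-- The box `[-1,1]^n × [0,1]` has lower corner `lowerCorner n` and upper corner `1`. -/
def lowerCorner (n : ℕ) : Fin (n + 1) → ℝ := fun i => if i = Fin.last n then 0 else -1

/-- The point of the hyperplane `y (Fin.last n) = 0` with the given first `n` coordinates. -/
def onFlat {n : ℕ} (x : Fin n → ℝ) : Fin (n + 1) → ℝ :=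
  Fin.insertNth (α := fun _ => ℝ) (Fin.last n) 0 x

lemma onFlat_last {n : ℕ} (x : Fin n → ℝ) : onFlat x (Fin.last n) = 0 :=
  Fin.insertNth_apply_same (α := fun _ => ℝ) _ _ _

lemma abs_le_of_sqNorm_le {n : ℕ} {y : Fin n → ℝ} (h : sqNorm y ≤ 9 / 25) (i : Fin n) :
    |y i| ≤ 3 / 5 := by
  refine abs_le_of_sq_le_sq ((sq_le_sqNorm y i).trans (h.trans ?_)) (by norm_num)
  norm_num

lemma closedHalf_subset_Icc (n : ℕ) : closedHalf n ⊆ Icc (lowerCorner n) 1 := by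
  intro y hy
  have h := fun i => abs_le.1 (abs_le_of_sqNorm_le hy.2 i)
  refine ⟨fun i => ?_, fun i => ?_⟩
  · unfold lowerCorner
    split_ifs with hi
    · subst hi; exact hy.1
    · linarith [(h i).1]
  · have := (h i).2
    simp only [Pi.one_apply]; linarith

lemma isClosed_closedHalf (n : ℕ) : IsClosed (closedHalf n) :=
  (isClosed_le continuous_const (continuous_apply _)).inter
    (isClosed_le continuous_sqNorm continuous_const)

lemma isCompact_closedHalf (n : ℕ) : IsCompact (closedHalf n) :=
  isCompact_Icc.of_isClosed_subset (isClosed_closedHalf n) (closedHalf_subset_Icc n)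

/-- `u` is harmonic in the open half-ball of radius `2/3`, with partial derivatives `v i`, and
is of class `C¹` up to the flat part of the boundary. -/
structure HarmonicUpTo {n : ℕ} (u : (Fin (n + 1) → ℝ) → ℝ)
    (v : Fin (n + 1) → (Fin (n + 1) → ℝ) → ℝ) : Prop where
  hasFDerivAt : ∀ y, 0 < y (Fin.last n) → sqNorm y < 4 / 9 →
    ∃ L : (Fin (n + 1) → ℝ) →L[ℝ] ℝ, HasFDerivAt u L y ∧ ∀ i, L (Pi.single i 1) = v i y
  harmonic : ∀ y, 0 < y (Fin.last n) → sqNorm y < 4 / 9 →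
    ∃ L : Fin (n + 1) → (Fin (n + 1) → ℝ) →L[ℝ] ℝ,
      (∀ i, HasFDerivAt (v i) (L i) y) ∧ ∑ i, L i (Pi.single i 1) = 0
  cont : ContinuousOn u {y | 0 ≤ y (Fin.last n) ∧ sqNorm y < 4 / 9}
  cont_grad : ∀ i, ContinuousOn (v i) {y | 0 ≤ y (Fin.last n) ∧ sqNorm y < 4 / 9}

/-- `Φ` is twice differentiable on the closed upper half-space, with partial derivatives `Φ₁ i`
and Laplacian `Φ₂`, and vanishes outside the ball of radius `3/5`. -/
structure IsTestFn {n : ℕ} (Φ : (Fin (n + 1) → ℝ) → ℂ)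
    (Φ₁ : Fin (n + 1) → (Fin (n + 1) → ℝ) → ℂ) (Φ₂ : (Fin (n + 1) → ℝ) → ℂ) : Prop where
  hasFDerivAt : ∀ y, 0 ≤ y (Fin.last n) →
    ∃ L : (Fin (n + 1) → ℝ) →L[ℝ] ℂ, HasFDerivAt Φ L y ∧ ∀ i, L (Pi.single i 1) = Φ₁ i y
  laplacian : ∀ y, 0 ≤ y (Fin.last n) →
    ∃ L : Fin (n + 1) → (Fin (n + 1) → ℝ) →L[ℝ] ℂ,
      (∀ i, HasFDerivAt (Φ₁ i) (L i) y) ∧ ∑ i, L i (Pi.single i 1) = Φ₂ y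
  cont : ContinuousOn Φ₂ (closedHalf n)
  eq_zero : ∀ y, 9 / 25 < sqNorm y → Φ y = 0
  grad_eq_zero : ∀ y, 9 / 25 < sqNorm y → ∀ i, Φ₁ i y = 0

lemma closedHalf_subset {n : ℕ} :
    closedHalf n ⊆ {y | 0 ≤ y (Fin.last n) ∧ sqNorm y < 4 / 9} :=
  fun _ hy => ⟨hy.1, hy.2.trans_lt (by norm_num)⟩

/-- Green's second identity on the half-ball, for a harmonic function and a test function. -/
lemma HarmonicUpTo.green {n : ℕ} {u : (Fin (n + 1) → ℝ) → ℝ}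
    {v : Fin (n + 1) → (Fin (n + 1) → ℝ) → ℝ} (hu : HarmonicUpTo u v)
    {Φ : (Fin (n + 1) → ℝ) → ℂ} {Φ₁ : Fin (n + 1) → (Fin (n + 1) → ℝ) → ℂ}
    {Φ₂ : (Fin (n + 1) → ℝ) → ℂ} (hΦ : IsTestFn Φ Φ₁ Φ₂) :
    ∫ y in closedHalf n, (u y : ℂ) * Φ₂ y =
      ∫ x in Icc (fun _ : Fin n => (-1 : ℝ)) 1,
        ((v (Fin.last n) (onFlat x) : ℂ) * Φ (onFlat x) -
          (u (onFlat x) : ℂ) * Φ₁ (Fin.last n) (onFlat x)) := by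
  set f : Fin (n + 1) → (Fin (n + 1) → ℝ) → ℂ :=
    fun i y => (v i y : ℂ) * Φ y - (u y : ℂ) * Φ₁ i y with hf
  have hf0 : ∀ i y, 9 / 25 < sqNorm y → f i y = 0 := fun i y hy => by
    simp [hf, hΦ.eq_zero y hy, hΦ.grad_eq_zero y hy i]
  have hfe : ∀ i y, 9 / 25 < sqNorm y → f i =ᶠ[nhds y] fun _ => 0 := fun i y hy => by
    filter_upwards [(isOpen_lt continuous_const continuous_sqNorm).mem_nhds hy] with z hz
    exact hf0 i z hz
  have hle : lowerCorner n ≤ 1 := fun i => by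
    unfold lowerCorner; split_ifs <;> simp
  have hcont : ∀ i, ContinuousOn (f i) (Icc (lowerCorner n) 1) := by
    intro i y hy
    have hy0 : 0 ≤ y (Fin.last n) := by simpa [lowerCorner] using hy.1 (Fin.last n)
    rcases lt_or_ge (9 / 25) (sqNorm y) with h | h
    · exact (continuousAt_const.congr (hfe i y h).symm).continuousWithinAt
    · have hlt : sqNorm y < 4 / 9 := h.trans_lt (by norm_num)
      have hmem : {y | 0 ≤ y (Fin.last n) ∧ sqNorm y < 4 / 9} ∈
          nhdsWithin y (Icc (lowerCorner n) 1) := by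
        filter_upwards [self_mem_nhdsWithin, mem_nhdsWithin_of_mem_nhds
          ((isOpen_lt continuous_sqNorm continuous_const).mem_nhds hlt)] with z hz hz'
        exact ⟨by simpa [lowerCorner] using hz.1 (Fin.last n), hz'⟩
      have hv := (hu.cont_grad i y ⟨hy0, hlt⟩).mono_of_mem_nhdsWithin hmem
      have hu' := (hu.cont y ⟨hy0, hlt⟩).mono_of_mem_nhdsWithin hmem
      obtain ⟨L, hL, -⟩ := hΦ.hasFDerivAt y hy0
      obtain ⟨L', hL', -⟩ := hΦ.laplacian y hy0
      exact ((Complex.continuous_ofReal.continuousAt.comp_continuousWithinAt hv).mul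
        hL.continuousAt.continuousWithinAt).sub
        ((Complex.continuous_ofReal.continuousAt.comp_continuousWithinAt hu').mul
        (hL' i).continuousAt.continuousWithinAt)
  have hinterior : ∀ y ∈ Set.pi univ (fun i => Ioo (lowerCorner n i) ((1 : Fin (n + 1) → ℝ) i)),
      0 < y (Fin.last n) := fun y hy => by
    simpa [lowerCorner] using (hy (Fin.last n) (mem_univ _)).1
  have hderiv : ∀ y, 0 < y (Fin.last n) →
      (∀ i, DifferentiableAt ℝ (f i) y) ∧ ∑ i, fderiv ℝ (f i) y (Pi.single i 1) =
        (closedHalf n).indicator (fun y => -((u y : ℂ) * Φ₂ y)) y := by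
    intro y hy
    rcases lt_or_ge (9 / 25) (sqNorm y) with h | h
    · refine ⟨fun i => (differentiableAt_const 0).congr_of_eventuallyEq (hfe i y h), ?_⟩
      rw [indicator_of_notMem fun hm => not_le.2 h hm.2]
      exact Finset.sum_eq_zero fun i _ => by rw [(hfe i y h).fderiv_eq]; simp
    · have hlt : sqNorm y < 4 / 9 := h.trans_lt (by norm_num)
      obtain ⟨A, hA, hAi⟩ := hu.hasFDerivAt y hy hlt
      obtain ⟨B, hB, hB0⟩ := hu.harmonic y hy hlt
      obtain ⟨L, hL, hLi⟩ := hΦ.hasFDerivAt y hy.le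
      obtain ⟨M, hM, hMi⟩ := hΦ.laplacian y hy.le
      have hof : ∀ {g : (Fin (n + 1) → ℝ) → ℝ} {g' : (Fin (n + 1) → ℝ) →L[ℝ] ℝ},
          HasFDerivAt g g' y →
          HasFDerivAt (fun y => (g y : ℂ)) (Complex.ofRealCLM.comp g') y := fun hg =>
        Complex.ofRealCLM.hasFDerivAt.comp y hg
      have hfd := fun i => ((hof (hB i)).mul hL).sub ((hof hA).mul (hM i))
      refine ⟨fun i => (hfd i).differentiableAt, ?_⟩
      have hmem : y ∈ closedHalf n := ⟨hy.le, h⟩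
      rw [indicator_of_mem hmem]
      have : ∀ i, fderiv ℝ (f i) y (Pi.single i 1) =
          Φ y * (B i (Pi.single i 1) : ℂ) - (u y : ℂ) * M i (Pi.single i 1) := by
        intro i
        rw [show fderiv ℝ (f i) y = _ from (hfd i).fderiv]
        simp [hAi, hLi]
        ring
      rw [Finset.sum_congr rfl fun i _ => this i, Finset.sum_sub_distrib, ← Finset.mul_sum,
        ← Finset.mul_sum, hMi, ← Complex.ofReal_sum, hB0]
      simp
  have hInt : IntegrableOn (fun y => -((u y : ℂ) * Φ₂ y)) (closedHalf n) :=
    (ContinuousOn.neg ((Complex.continuous_ofReal.comp_continuousOn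
      (hu.cont.mono closedHalf_subset)).mul hΦ.cont)).integrableOn_compact (isCompact_closedHalf n)
  have hae : Set.pi univ (fun i => Ioo (lowerCorner n i) ((1 : Fin (n + 1) → ℝ) i)) =ᵐ[volume]
      Icc (lowerCorner n) 1 := Measure.univ_pi_Ioo_ae_eq_Icc
  have hmeas : MeasurableSet
      (Set.pi univ (fun i => Ioo (lowerCorner n i) ((1 : Fin (n + 1) → ℝ) i))) :=
    MeasurableSet.univ_pi fun i => measurableSet_Ioo
  have hEq : EqOn (fun y => ∑ i, fderiv ℝ (f i) y (Pi.single i 1))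
      ((closedHalf n).indicator (fun y => -((u y : ℂ) * Φ₂ y)))
      (Set.pi univ (fun i => Ioo (lowerCorner n i) ((1 : Fin (n + 1) → ℝ) i))) :=
    fun y hy => (hderiv y (hinterior y hy)).2
  have hIntD : IntegrableOn (fun y => ∑ i, fderiv ℝ (f i) y (Pi.single i 1))
      (Icc (lowerCorner n) 1) := by
    refine IntegrableOn.congr_set_ae ?_ hae.symm
    refine IntegrableOn.congr_fun ?_ hEq.symm hmeas
    exact (hInt.integrable_indicator (isClosed_closedHalf n).measurableSet).integrableOn
  have key := integral_divergence_of_hasFDerivAt_off_countable' (lowerCorner n) 1 hle f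
    (fun i => fderiv ℝ (f i)) ∅ countable_empty hcont
    (fun y hy i => ((hderiv y (hinterior y hy.1)).1 i).hasFDerivAt) hIntD
  have hL : ∫ y in Icc (lowerCorner n) 1, ∑ i, fderiv ℝ (f i) y (Pi.single i 1) =
      -∫ y in closedHalf n, (u y : ℂ) * Φ₂ y := by
    rw [← setIntegral_congr_set hae, setIntegral_congr_fun hmeas hEq, setIntegral_congr_set hae,
      setIntegral_indicator (isClosed_closedHalf n).measurableSet,
      inter_eq_self_of_subset_right (closedHalf_subset_Icc n), integral_neg]
  have hone : ∀ (i : Fin (n + 1)) (c : ℝ) (x : Fin n → ℝ), c ^ 2 = 1 →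
      f i (Fin.insertNth (α := fun _ => ℝ) i c x) = 0 := by
    intro i c x hc
    refine hf0 i _ (lt_of_lt_of_le ?_ (sq_le_sqNorm _ i))
    rw [Fin.insertNth_apply_same, hc]; norm_num
  rw [hL, Finset.sum_eq_single (Fin.last n)] at key
  · rw [setIntegral_congr_fun (g := fun _ => (0 : ℂ)) measurableSet_Icc
      (fun x _ => hone _ _ x (by simp))] at key
    simp only [integral_zero, zero_sub, neg_inj] at key
    rw [key]
    have h1 : lowerCorner n ∘ (Fin.last n).succAbove = fun _ => -1 := by
      funext i; simp [lowerCorner, (Fin.castSucc_lt_last i).ne]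
    have h2 : lowerCorner n (Fin.last n) = 0 := by simp [lowerCorner]
    rw [h1, h2]
    rfl
  · intro i _ hi
    rw [setIntegral_congr_fun (g := fun _ => (0 : ℂ)) measurableSet_Icc
      (fun x _ => hone _ _ x (by simp)), setIntegral_congr_fun (g := fun _ => (0 : ℂ))
      measurableSet_Icc (fun x _ => hone _ _ x (by simp [lowerCorner, hi]))]
    simp
  · simp

/-- A smooth cutoff, equal to `1` where `sqNorm y ≤ 1/4` and to `0` where `9/25 ≤ sqNorm y`. -/
def cutoff {n : ℕ} (y : Fin n → ℝ) : ℝ := Real.smoothTransition ((9 / 25 - sqNorm y) * (100 / 11))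

/-- The partial derivatives of `cutoff`. -/
def cutoffGrad {n : ℕ} (i : Fin n) (y : Fin n → ℝ) : ℝ := fderiv ℝ cutoff y (Pi.single i 1)

/-- The Laplacian of `cutoff`. -/
def cutoffLap {n : ℕ} (y : Fin n → ℝ) : ℝ := ∑ i, fderiv ℝ (cutoffGrad i) y (Pi.single i 1)

lemma contDiff_cutoff {n : ℕ} : ContDiff ℝ 3 (cutoff (n := n)) := by
  unfold cutoff sqNorm
  exact Real.smoothTransition.contDiff.comp (by fun_prop)

lemma contDiff_cutoffGrad {n : ℕ} (i : Fin n) : ContDiff ℝ 2 (cutoffGrad i) :=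
  (contDiff_cutoff.fderiv_right (m := 2) (by norm_num)).clm_apply contDiff_const

lemma continuous_cutoffLap {n : ℕ} : Continuous (cutoffLap (n := n)) :=
  continuous_finsetSum _ fun i _ =>
    (((contDiff_cutoffGrad i).fderiv_right (m := 1) (by norm_num)).clm_apply
      contDiff_const).continuous

lemma cutoff_eq_one {n : ℕ} {y : Fin n → ℝ} (h : sqNorm y ≤ 1 / 4) : cutoff y = 1 :=
  Real.smoothTransition.one_of_one_le (by linarith)

lemma cutoff_eq_zero {n : ℕ} {y : Fin n → ℝ} (h : 9 / 25 ≤ sqNorm y) : cutoff y = 0 :=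
  Real.smoothTransition.zero_of_nonpos (by linarith)

lemma abs_cutoff_le {n : ℕ} (y : Fin n → ℝ) : |cutoff y| ≤ 1 :=
  abs_le.2 ⟨(by norm_num : (-1 : ℝ) ≤ 0).trans (Real.smoothTransition.nonneg _),
    Real.smoothTransition.le_one _⟩

lemma cutoffGrad_eq_zero {n : ℕ} {y : Fin n → ℝ} (h : sqNorm y < 1 / 4 ∨ 9 / 25 < sqNorm y)
    (i : Fin n) : cutoffGrad i y = 0 := by
  obtain ⟨c, hc⟩ : ∃ c : ℝ, cutoff =ᶠ[nhds y] fun _ => c := by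
    rcases h with h | h
    · refine ⟨1, ?_⟩
      filter_upwards [(isOpen_lt continuous_sqNorm continuous_const).mem_nhds h] with z hz
      exact cutoff_eq_one (le_of_lt hz)
    · refine ⟨0, ?_⟩
      filter_upwards [(isOpen_lt continuous_const continuous_sqNorm).mem_nhds h] with z hz
      exact cutoff_eq_zero (le_of_lt hz)
  rw [cutoffGrad, hc.fderiv_eq]; simp

lemma cutoffLap_eq_zero {n : ℕ} {y : Fin n → ℝ} (h : sqNorm y < 1 / 4) : cutoffLap y = 0 := by
  refine Finset.sum_eq_zero fun i _ => ?_
  have : cutoffGrad i =ᶠ[nhds y] fun _ => 0 := by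
    filter_upwards [(isOpen_lt continuous_sqNorm continuous_const).mem_nhds h] with z hz
    exact cutoffGrad_eq_zero (Or.inl hz) i
  rw [this.fderiv_eq]; simp

/-- The square of the distance from `y` to the point with last coordinate `z` (possibly complex)
and other coordinates `0`, regularised by `η ^ 2`. -/
def distSq {n : ℕ} (η : ℝ) (z : ℂ) (y : Fin (n + 1) → ℝ) : ℂ :=
  ((sqNorm y + η ^ 2 : ℝ) : ℂ) - 2 * z * (y (Fin.last n) : ℂ) + z ^ 2

/-- The partial derivatives of `distSq η z`. -/
def distSqGrad {n : ℕ} (z : ℂ) (i : Fin (n + 1)) (y : Fin (n + 1) → ℝ) : ℂ :=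
  2 * ((y i : ℂ) - if i = Fin.last n then z else 0)

/-- A negative power of `distSq`. -/
def kern {n : ℕ} (k : ℕ) (η : ℝ) (z : ℂ) (y : Fin (n + 1) → ℝ) : ℂ := (distSq η z y ^ k)⁻¹

lemma hasFDerivAt_coord {n : ℕ} (i : Fin n) (y : Fin n → ℝ) :
    HasFDerivAt (fun y : Fin n → ℝ => (y i : ℂ))
      (Complex.ofRealCLM.comp (ContinuousLinearMap.proj (R := ℝ) i)) y :=
  (Complex.ofRealCLM.comp (ContinuousLinearMap.proj (R := ℝ) (φ := fun _ => ℝ) i)).hasFDerivAt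

lemma hasFDerivAt_distSq {n : ℕ} (η : ℝ) (z : ℂ) (y : Fin (n + 1) → ℝ) :
    ∃ L : (Fin (n + 1) → ℝ) →L[ℝ] ℂ, HasFDerivAt (distSq η z) L y ∧
      ∀ i, L (Pi.single i 1) = distSqGrad z i y := by
  have h := ((((HasFDerivAt.fun_sum (u := Finset.univ) fun i _ =>
    (hasFDerivAt_coord i y).pow 2).add_const ((η : ℂ) ^ 2)).sub
    ((hasFDerivAt_coord (Fin.last n) y).const_mul (2 * z))).add_const (z ^ 2))
  refine ⟨_, h.congr_of_eventuallyEq (.of_forall fun y => ?_), fun i => ?_⟩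
  · simp [distSq, sqNorm]
  · have hsum : ∀ c : Fin (n + 1) → ℂ, ∑ j, c j * ((Pi.single i 1 : Fin (n + 1) → ℝ) j : ℂ) =
        c i := fun c => by
      rw [Finset.sum_eq_single i (fun j _ hj => by simp [Pi.single_eq_of_ne hj]) (by simp)]
      simp
    have := hsum fun j => 2 * (y j : ℂ)
    simp only [sub_apply, sum_apply, smul_apply, ContinuousLinearMap.comp_apply,
      ContinuousLinearMap.proj_apply, Complex.ofRealCLM_apply, smul_eq_mul, distSqGrad]
    rcases eq_or_ne i (Fin.last n) with rfl | hi
    · simp at this ⊢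
      rw [this]; ring
    · simp [hi] at this ⊢
      rw [this]

lemma hasFDerivAt_kern {n : ℕ} (k : ℕ) (η : ℝ) (z : ℂ) {y : Fin (n + 1) → ℝ}
    (hy : distSq η z y ≠ 0) :
    ∃ L : (Fin (n + 1) → ℝ) →L[ℝ] ℂ, HasFDerivAt (kern k η z) L y ∧
      ∀ i, L (Pi.single i 1) = -(k * kern (k + 1) η z y * distSqGrad z i y) := by
  obtain ⟨L, hL, hLi⟩ := hasFDerivAt_distSq η z y
  have h1 : HasDerivAt (fun w : ℂ => (w ^ k)⁻¹) (-(k * (distSq η z y ^ (k + 1))⁻¹))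
      (distSq η z y) := by
    refine ((hasDerivAt_pow k (distSq η z y)).fun_inv (pow_ne_zero k hy)).congr_deriv ?_
    rcases k with _ | k
    · simp
    · simp only [Nat.add_sub_cancel]
      field_simp
      ring
  refine ⟨_, h1.comp_hasFDerivAt y hL, fun i => ?_⟩
  simp [hLi, kern]

lemma hasFDerivAt_distSqGrad {n : ℕ} (z : ℂ) (i : Fin (n + 1)) (y : Fin (n + 1) → ℝ) :
    ∃ L : (Fin (n + 1) → ℝ) →L[ℝ] ℂ, HasFDerivAt (distSqGrad z i) L y ∧
      L (Pi.single i 1) = 2 := by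
  refine ⟨_, ((hasFDerivAt_coord i y).sub_const _).const_mul 2, ?_⟩
  simp

lemma sum_distSqGrad_sq {n : ℕ} (η : ℝ) (z : ℂ) (y : Fin (n + 1) → ℝ) :
    ∑ i, distSqGrad z i y ^ 2 = 4 * (distSq η z y - η ^ 2) := by
  simp only [distSqGrad, distSq, sqNorm, Fin.sum_univ_castSucc]
  simp only [(Fin.castSucc_lt_last _).ne, if_false, if_true, sub_zero, mul_pow]
  rw [← Finset.mul_sum]
  push_cast
  ring

/-- The part of the Laplacian of `cutoff * kern a` that is supported away from the origin. -/
def capKern {n : ℕ} (a : ℕ) (η : ℝ) (z : ℂ) (y : Fin (n + 1) → ℝ) : ℂ :=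
  cutoffLap y * kern a η z y -
    2 * a * kern (a + 1) η z y * ∑ i, cutoffGrad i y * distSqGrad z i y

lemma continuousOn_kern {n : ℕ} (k : ℕ) (η : ℝ) (z : ℂ) {s : Set (Fin (n + 1) → ℝ)}
    (h : ∀ y ∈ s, distSq η z y ≠ 0) : ContinuousOn (kern k η z) s := fun y hy =>
  (hasFDerivAt_kern k η z (h y hy)).choose_spec.1.continuousAt.continuousWithinAt

lemma continuous_distSqGrad {n : ℕ} (i : Fin (n + 1)) :
    Continuous (fun p : ℂ × (Fin (n + 1) → ℝ) => distSqGrad p.1 i p.2) := by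
  unfold distSqGrad
  split_ifs <;> fun_prop

lemma isTestFn_cutoff_mul_kern {n a : ℕ} (hn : n = 2 * a + 1) (η : ℝ) (z : ℂ)
    (hz : ∀ y : Fin (n + 1) → ℝ, 0 ≤ y (Fin.last n) → distSq η z y ≠ 0) :
    IsTestFn (fun y : Fin (n + 1) → ℝ => cutoff y * kern a η z y)
      (fun i y => cutoffGrad i y * kern a η z y -
        cutoff y * (a * kern (a + 1) η z y * distSqGrad z i y))
      (fun y => capKern a η z y - cutoff y * (4 * a * (a + 1) * η ^ 2 * kern (a + 2) η z y)) := by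
  have hof : ∀ {g : (Fin (n + 1) → ℝ) → ℝ} {y : Fin (n + 1) → ℝ}, DifferentiableAt ℝ g y →
      HasFDerivAt (fun y => (g y : ℂ)) (Complex.ofRealCLM.comp (fderiv ℝ g y)) y := fun hg =>
    Complex.ofRealCLM.hasFDerivAt.comp _ hg.hasFDerivAt
  have hχ : ∀ y : Fin (n + 1) → ℝ, DifferentiableAt ℝ cutoff y := fun y =>
    (contDiff_cutoff.differentiable (by norm_num)) y
  have hχ1 : ∀ (i) (y : Fin (n + 1) → ℝ), DifferentiableAt ℝ (cutoffGrad i) y := fun i y =>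
    ((contDiff_cutoffGrad i).differentiable (by norm_num)) y
  refine ⟨fun y hy => ?_, fun y hy => ?_, ?_, fun y hy => ?_, fun y hy i => ?_⟩
  · obtain ⟨L, hL, hLi⟩ := hasFDerivAt_kern a η z (hz y hy)
    refine ⟨_, (hof (hχ y)).mul hL, fun i => ?_⟩
    simp [hLi, cutoffGrad]
    ring
  · obtain ⟨L, hL, hLi⟩ := hasFDerivAt_kern a η z (hz y hy)
    obtain ⟨M, hM, hMi⟩ := hasFDerivAt_kern (a + 1) η z (hz y hy)
    choose N hN hNi using fun i => hasFDerivAt_distSqGrad z i y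
    refine ⟨_, fun i => ((hof (hχ1 i y)).mul hL).sub
      ((hof (hχ y)).mul ((hM.const_mul (a : ℂ)).mul (hN i))), ?_⟩
    have hterm : ∀ i : Fin (n + 1), (cutoffGrad i y : ℂ) = fderiv ℝ cutoff y (Pi.single i 1) :=
      fun i => rfl
    have hk : kern (a + 1) η z y = kern (a + 2) η z y * distSq η z y := by
      have := hz y hy
      unfold kern; field_simp; ring
    have hsq := sum_distSqGrad_sq η z y
    have hlap : (cutoffLap y : ℂ) =
        ∑ i, (fderiv ℝ (cutoffGrad i) y (Pi.single i 1) : ℂ) := by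
      rw [cutoffLap, Complex.ofReal_sum]
    calc _ = ∑ i, ((fderiv ℝ (cutoffGrad i) y (Pi.single i 1) : ℂ) * kern a η z y
          - 2 * a * kern (a + 1) η z y * (cutoffGrad i y * distSqGrad z i y)
          + cutoff y * a * (a + 1) * kern (a + 2) η z y * distSqGrad z i y ^ 2
          - 2 * cutoff y * a * kern (a + 1) η z y) := by
            refine Finset.sum_congr rfl fun i _ => ?_
            simp [hLi, hMi, hNi, hterm]
            ring
      _ = _ := by
        rw [Finset.sum_sub_distrib, Finset.sum_add_distrib, Finset.sum_sub_distrib,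
          ← Finset.sum_mul, ← Finset.mul_sum, ← Finset.mul_sum, hsq, ← hlap]
        simp only [Finset.sum_const, Finset.card_univ, Fintype.card_fin, nsmul_eq_mul, capKern]
        have hn' : (n : ℂ) = 2 * a + 1 := by rw [hn]; push_cast; ring
        rw [hk]
        push_cast
        rw [hn']
        ring
  · have hz' : ∀ y ∈ closedHalf n, distSq η z y ≠ 0 := fun y hy => hz y hy.1
    have hk := fun k => continuousOn_kern k η z hz'
    have h0 : Continuous fun y : Fin (n + 1) → ℝ => (cutoff y : ℂ) :=
      Complex.continuous_ofReal.comp contDiff_cutoff.continuous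
    have h1 : Continuous fun y : Fin (n + 1) → ℝ =>
        ∑ i, (cutoffGrad i y : ℂ) * distSqGrad z i y :=
      continuous_finsetSum _ fun i _ =>
        (Complex.continuous_ofReal.comp (contDiff_cutoffGrad i).continuous).mul
          ((continuous_distSqGrad i).comp (by fun_prop : Continuous fun y => (z, y)))
    have h2 : Continuous fun y : Fin (n + 1) → ℝ => (cutoffLap y : ℂ) :=
      Complex.continuous_ofReal.comp continuous_cutoffLap
    exact ((h2.continuousOn.mul (hk a)).sub
      ((continuousOn_const.mul (hk (a + 1))).mul h1.continuousOn)).sub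
      (h0.continuousOn.mul (continuousOn_const.mul (hk (a + 2))))
  · simp [cutoff_eq_zero hy.le]
  · simp [cutoff_eq_zero hy.le, cutoffGrad_eq_zero (Or.inr hy)]

lemma sq_sub_norm_le_norm_quadratic {A b r : ℝ} {w : ℂ} (hrA : r ^ 2 ≤ A)
    (hb : b ^ 2 ≤ A) (hw : ‖w‖ ≤ r) :
    (r - ‖w‖) ^ 2 ≤ ‖(A : ℂ) - 2 * w * b + w ^ 2‖ := by
  set c : ℂ := ⟨b, √(A - b ^ 2)⟩ with hc
  have hsq : √(A - b ^ 2) ^ 2 = A - b ^ 2 := Real.sq_sqrt (by linarith)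
  have hfac : (A : ℂ) - 2 * w * b + w ^ 2 = (c - w) * ((starRingEnd ℂ) c - w) := by
    have h1 : c * (starRingEnd ℂ) c = (A : ℂ) := by
      rw [Complex.mul_conj, Complex.normSq_mk]
      congr 1; nlinarith
    have h2 : c + (starRingEnd ℂ) c = ((2 * b : ℝ) : ℂ) := by
      rw [Complex.add_conj]
    push_cast at h2
    linear_combination -h1 + w * h2
  have hnc : r ≤ ‖c‖ := by
    refine le_of_sq_le_sq ?_ (norm_nonneg _)
    rw [← Complex.normSq_eq_norm_sq, hc, Complex.normSq_mk]
    nlinarith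
  have h1 : r - ‖w‖ ≤ ‖c - w‖ := (sub_le_sub_right hnc _).trans (norm_sub_norm_le _ _)
  have h2 : r - ‖w‖ ≤ ‖(starRingEnd ℂ) c - w‖ := by
    refine (sub_le_sub_right hnc _).trans ?_
    rw [← Complex.norm_conj c]
    exact norm_sub_norm_le _ _
  rw [hfac, norm_mul, sq]
  exact mul_le_mul h1 h2 (by linarith) (norm_nonneg _)

lemma sq_sub_norm_le_norm_distSq {n : ℕ} {η r : ℝ} {w : ℂ} {y : Fin (n + 1) → ℝ}
    (hy : 0 ≤ y (Fin.last n)) (hrS : r ^ 2 ≤ sqNorm y + 1 / 64) (hw : ‖w‖ ≤ r) :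
    (r - ‖w‖) ^ 2 ≤ ‖distSq η (w - 1 / 8) y‖ := by
  have hS := sq_le_sqNorm y (Fin.last n)
  have h := sq_sub_norm_le_norm_quadratic (A := sqNorm y + y (Fin.last n) / 4 + 1 / 64 + η ^ 2)
    (b := y (Fin.last n) + 1 / 8) (by nlinarith [sq_nonneg η]) (by nlinarith [sq_nonneg η]) hw
  refine h.trans (le_of_eq ?_)
  congr 1
  unfold distSq
  push_cast
  ring

lemma distSq_ofReal {n : ℕ} (η t : ℝ) (y : Fin (n + 1) → ℝ) :
    distSq η (t : ℂ) y = ((sqNorm (Pi.single (Fin.last n) t - y) + η ^ 2 : ℝ) : ℂ) := by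
  simp only [distSq, sqNorm, Fin.sum_univ_castSucc, Pi.sub_apply, Pi.single_eq_same,
    Pi.single_eq_of_ne (Fin.castSucc_lt_last _).ne]
  push_cast
  ring_nf

lemma norm_kern_le {n k l : ℕ} {η κ : ℝ} {z : ℂ} {y : Fin (n + 1) → ℝ} (hκ : 0 < κ)
    (hκ1 : κ ≤ 1) (hy : κ ≤ ‖distSq η z y‖) (hkl : k ≤ l) : ‖kern k η z y‖ ≤ (κ ^ l)⁻¹ := by
  rw [kern, norm_inv, norm_pow]
  refine inv_anti₀ (by positivity) ?_
  exact (pow_le_pow_of_le_one hκ.le hκ1 hkl).trans (pow_le_pow_left₀ hκ.le hy _)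

lemma norm_distSqGrad_le {n : ℕ} {z : ℂ} {y : Fin (n + 1) → ℝ} (hy : sqNorm y ≤ 9 / 25)
    (hz : ‖z‖ ≤ 1) (i : Fin (n + 1)) : ‖distSqGrad z i y‖ ≤ 4 := by
  have h1 := abs_le_of_sqNorm_le hy i
  rw [distSqGrad, norm_mul]
  have : ‖(y i : ℂ) - if i = Fin.last n then z else 0‖ ≤ 2 := by
    refine (norm_sub_le _ _).trans ?_
    rw [Complex.norm_real, Real.norm_eq_abs]
    split_ifs
    · linarith
    · simp only [norm_zero]; linarith
  simp only [Complex.norm_ofNat]; linarith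

lemma exists_cutoff_bound (n : ℕ) : ∃ B : ℝ, 0 < B ∧ ∀ y ∈ closedHalf n,
    |cutoffLap y| ≤ B ∧ ∀ i, |cutoffGrad i y| ≤ B := by
  obtain ⟨B, hB⟩ := (isCompact_closedHalf n).exists_bound_of_continuousOn
    continuous_cutoffLap.continuousOn
  choose D hD using fun i => (isCompact_closedHalf n).exists_bound_of_continuousOn
    (contDiff_cutoffGrad i).continuous.continuousOn
  refine ⟨1 + |B| + ∑ i, |D i|, by positivity, fun y hy => ⟨?_, fun i => ?_⟩⟩
  · have h1 := hB y hy
    have h2 : 0 ≤ ∑ i, |D i| := by positivity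
    rw [Real.norm_eq_abs] at h1
    linarith [le_abs_self B]
  · have h1 := hD i y hy
    have h2 := Finset.single_le_sum (f := fun i => |D i|) (fun _ _ => abs_nonneg _)
      (Finset.mem_univ i)
    rw [Real.norm_eq_abs] at h1
    linarith [le_abs_self (D i), abs_nonneg B]

lemma norm_capKern_le {n a : ℕ} {B η κ : ℝ} {z : ℂ} {y : Fin (n + 1) → ℝ}
    (hB : |cutoffLap y| ≤ B ∧ ∀ i, |cutoffGrad i y| ≤ B) (hS : sqNorm y ≤ 9 / 25) (hz : ‖z‖ ≤ 1)
    (hκ : 0 < κ) (hκ1 : κ ≤ 1) (hy : κ ≤ ‖distSq η z y‖) :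
    ‖capKern a η z y‖ ≤ B * (1 + 8 * a * (n + 1)) * (κ ^ (a + 2))⁻¹ := by
  have hB0 : 0 ≤ B := (abs_nonneg _).trans hB.1
  have hk1 := norm_kern_le hκ hκ1 hy (show a ≤ a + 2 by omega)
  have hk2 := norm_kern_le hκ hκ1 hy (show a + 1 ≤ a + 2 by omega)
  have hκ' : 0 ≤ (κ ^ (a + 2))⁻¹ := by positivity
  have hsum : ‖∑ i, (cutoffGrad i y : ℂ) * distSqGrad z i y‖ ≤ (n + 1) * (B * 4) := by
    refine (norm_sum_le _ _).trans ?_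
    refine (Finset.sum_le_card_nsmul _ _ (B * 4) fun i _ => ?_).trans (by simp)
    rw [norm_mul, Complex.norm_real, Real.norm_eq_abs]
    exact mul_le_mul (hB.2 i) (norm_distSqGrad_le hS hz i) (norm_nonneg _) hB0
  calc ‖capKern a η z y‖ ≤ |cutoffLap y| * ‖kern a η z y‖ + 2 * a * ‖kern (a + 1) η z y‖ *
        ‖∑ i, (cutoffGrad i y : ℂ) * distSqGrad z i y‖ := by
        refine (norm_sub_le _ _).trans (le_of_eq ?_)
        simp
    _ ≤ B * (κ ^ (a + 2))⁻¹ + 2 * a * (κ ^ (a + 2))⁻¹ * ((n + 1) * (B * 4)) := by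
        gcongr
        exact hB.1
    _ = _ := by ring

/-- The contribution of the flat part of the boundary in Green's identity. -/
def flatTerm {n : ℕ} (a : ℕ) (u w : (Fin (n + 1) → ℝ) → ℝ) (η : ℝ) (z : ℂ) : ℂ :=
  ∫ x in Icc (fun _ : Fin n => (-1 : ℝ)) 1,
    ((w (onFlat x) : ℂ) * (cutoff (onFlat x) * kern a η z (onFlat x)) -
      (u (onFlat x) : ℂ) * (cutoffGrad (Fin.last n) (onFlat x) * kern a η z (onFlat x) -
        cutoff (onFlat x) * (a * kern (a + 1) η z (onFlat x) *
          distSqGrad z (Fin.last n) (onFlat x))))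

/-- The contribution of the mollified point mass in Green's identity. -/
def tailTerm {n : ℕ} (a : ℕ) (u : (Fin (n + 1) → ℝ) → ℝ) (η : ℝ) (z : ℂ) : ℂ :=
  ∫ y in closedHalf n,
    (u y : ℂ) * (cutoff y * (4 * a * (a + 1) * η ^ 2 * kern (a + 2) η z y))

/-- The part of the half-ball where the cutoff is not constant. -/
def capSet (n : ℕ) : Set (Fin (n + 1) → ℝ) := closedHalf n ∩ {y | 1 / 4 ≤ sqNorm y}

/-- The contribution of the spherical cap in Green's identity. -/
def capTerm {n : ℕ} (a : ℕ) (u : (Fin (n + 1) → ℝ) → ℝ) (η : ℝ) (z : ℂ) : ℂ :=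
  ∫ y in capSet n, (u y : ℂ) * capKern a η z y

lemma isCompact_capSet (n : ℕ) : IsCompact (capSet n) :=
  (isCompact_closedHalf n).inter_right (isClosed_le continuous_const continuous_sqNorm)

lemma HarmonicUpTo.capTerm_sub_tailTerm {n a : ℕ} (hn : n = 2 * a + 1)
    {u : (Fin (n + 1) → ℝ) → ℝ} {v : Fin (n + 1) → (Fin (n + 1) → ℝ) → ℝ}
    (hu : HarmonicUpTo u v) (η : ℝ) (z : ℂ)
    (hz : ∀ y : Fin (n + 1) → ℝ, 0 ≤ y (Fin.last n) → distSq η z y ≠ 0) :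
    capTerm a u η z - tailTerm a u η z = flatTerm a u (v (Fin.last n)) η z := by
  have hT := isTestFn_cutoff_mul_kern hn η z hz
  have huc : ContinuousOn (fun y => (u y : ℂ)) (closedHalf n) :=
    Complex.continuous_ofReal.comp_continuousOn (hu.cont.mono closedHalf_subset)
  have htail : ContinuousOn (fun y : Fin (n + 1) → ℝ =>
      (cutoff y : ℂ) * (4 * a * (a + 1) * η ^ 2 * kern (a + 2) η z y)) (closedHalf n) :=
    (Complex.continuous_ofReal.comp contDiff_cutoff.continuous).continuousOn.mul
      (continuousOn_const.mul (continuousOn_kern _ _ _ fun y hy => hz y hy.1))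
  have hcap : ContinuousOn (capKern a η z) (closedHalf n) :=
    (hT.cont.add htail).congr fun y _ => by simp
  have hcapTerm : capTerm a u η z = ∫ y in closedHalf n, (u y : ℂ) * capKern a η z y := by
    refine (setIntegral_eq_of_subset_of_forall_sdiff_eq_zero
      (isClosed_closedHalf n).measurableSet inter_subset_left fun y hy => ?_).symm
    have hS : sqNorm y < 1 / 4 := not_le.1 fun h => hy.2 ⟨hy.1, h⟩
    simp [capKern, cutoffLap_eq_zero hS, cutoffGrad_eq_zero (Or.inl hS)]
  have hI₁ : IntegrableOn (fun y => (u y : ℂ) * capKern a η z y) (closedHalf n) :=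
    (huc.mul hcap).integrableOn_compact (isCompact_closedHalf n)
  have hI₂ : IntegrableOn (fun y => (u y : ℂ) * (cutoff y *
      (4 * a * (a + 1) * η ^ 2 * kern (a + 2) η z y))) (closedHalf n) :=
    (huc.mul htail).integrableOn_compact (isCompact_closedHalf n)
  rw [flatTerm, ← hu.green hT, hcapTerm, tailTerm, ← integral_sub hI₁ hI₂]
  simp only [mul_sub]

lemma norm_flatTerm_le {n a : ℕ} {u w : (Fin (n + 1) → ℝ) → ℝ} {B ε η κ : ℝ} {z : ℂ}
    (hB : ∀ y ∈ closedHalf n, |cutoffLap y| ≤ B ∧ ∀ i, |cutoffGrad i y| ≤ B)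
    (hB0 : 0 ≤ B) (hε : 0 ≤ ε)
    (hflat : ∀ y, y (Fin.last n) = 0 → sqNorm y < 4 / 9 → |u y| ≤ ε ∧ |w y| ≤ ε)
    (hz : ‖z‖ ≤ 1) (hκ : 0 < κ) (hκ1 : κ ≤ 1)
    (hκd : ∀ y : Fin (n + 1) → ℝ, y (Fin.last n) = 0 → κ ≤ ‖distSq η z y‖) :
    ‖flatTerm a u w η z‖ ≤
      ε * (1 + B + 4 * a) * (κ ^ (a + 2))⁻¹ *
        volume.real (Icc (fun _ : Fin n => (-1 : ℝ)) 1) := by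
  refine norm_setIntegral_le_of_norm_le_const isCompact_Icc.measure_lt_top fun x _ => ?_
  set y := onFlat x
  have hy0 : y (Fin.last n) = 0 := onFlat_last x
  have hκ' : 0 ≤ (κ ^ (a + 2))⁻¹ := by positivity
  rcases lt_or_ge (9 / 25) (sqNorm y) with h | h
  · simp only [cutoff_eq_zero h.le, cutoffGrad_eq_zero (Or.inr h)]
    simp
    positivity
  · have hB' := (hB y ⟨hy0.ge, h⟩).2 (Fin.last n)
    obtain ⟨h1, h2⟩ := hflat y hy0 (h.trans_lt (by norm_num))
    have hk1 := norm_kern_le hκ hκ1 (hκd y hy0) (show a ≤ a + 2 by omega)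
    have hk2 := norm_kern_le hκ hκ1 (hκd y hy0) (show a + 1 ≤ a + 2 by omega)
    have hg := norm_distSqGrad_le h hz (Fin.last n)
    have hχ := abs_cutoff_le y
    calc _ ≤ |w y| * (|cutoff y| * ‖kern a η z y‖) + |u y| *
          (|cutoffGrad (Fin.last n) y| * ‖kern a η z y‖ +
            |cutoff y| * (a * ‖kern (a + 1) η z y‖ * ‖distSqGrad z (Fin.last n) y‖)) := by
          refine (norm_sub_le _ _).trans ?_
          simp only [norm_mul, Complex.norm_real, Real.norm_eq_abs]
          gcongr
          refine (norm_sub_le _ _).trans (le_of_eq ?_)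
          simp
      _ ≤ ε * (1 * (κ ^ (a + 2))⁻¹) + ε *
          (B * (κ ^ (a + 2))⁻¹ + 1 * (a * (κ ^ (a + 2))⁻¹ * 4)) := by
          gcongr
      _ = _ := by ring

lemma norm_tailTerm_le {n a : ℕ} {u : (Fin (n + 1) → ℝ) → ℝ} {η κ : ℝ} {z : ℂ}
    (hu : ∀ y, 0 ≤ y (Fin.last n) → sqNorm y < 4 / 9 → |u y| ≤ 1)
    (hκ : 0 < κ) (hκ1 : κ ≤ 1)
    (hκd : ∀ y : Fin (n + 1) → ℝ, 0 ≤ y (Fin.last n) → κ ≤ ‖distSq η z y‖) :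
    ‖tailTerm a u η z‖ ≤
      4 * a * (a + 1) * η ^ 2 * (κ ^ (a + 2))⁻¹ * volume.real (closedHalf n) := by
  refine norm_setIntegral_le_of_norm_le_const (isCompact_closedHalf n).measure_lt_top
    fun y hy => ?_
  have hk := norm_kern_le hκ hκ1 (hκd y hy.1) le_rfl (k := a + 2)
  have h1 := hu y hy.1 (closedHalf_subset hy).2
  have hχ := abs_cutoff_le y
  have hκ' : 0 ≤ (κ ^ (a + 2))⁻¹ := by positivity
  calc _ = |u y| * (|cutoff y| * (4 * a * (a + 1) * η ^ 2 * ‖kern (a + 2) η z y‖)) := by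
        simp only [norm_mul, Complex.norm_real, Real.norm_eq_abs, norm_pow, sq_abs,
          Complex.norm_natCast, Complex.norm_ofNat]
        rw [show ‖(a : ℂ) + 1‖ = a + 1 by exact_mod_cast Complex.norm_natCast (a + 1)]
    _ ≤ 1 * (1 * (4 * a * (a + 1) * η ^ 2 * (κ ^ (a + 2))⁻¹)) := by gcongr
    _ = _ := by ring

lemma continuous_distSq {n : ℕ} (η : ℝ) :
    Continuous (fun p : ℂ × (Fin (n + 1) → ℝ) => distSq η p.1 p.2) := by
  unfold distSq sqNorm
  fun_prop

lemma differentiableOn_capTerm {n : ℕ} (a : ℕ) (η : ℝ) {u : (Fin (n + 1) → ℝ) → ℝ}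
    (hu : ContinuousOn u (closedHalf n)) {U : Set ℂ} (hU : IsOpen U)
    (hd : ∀ z ∈ U, ∀ y ∈ capSet n, distSq η z y ≠ 0) :
    DifferentiableOn ℂ (capTerm a u η) U := by
  have hcap : capSet n ⊆ closedHalf n := inter_subset_left
  refine differentiableOn_setIntegral (isCompact_capSet n) hU
    (G := fun z y => (u y : ℂ) * capKern a η z y) ?_ fun y hy => ?_
  · have hsnd : MapsTo Prod.snd (U ×ˢ capSet n) (closedHalf n) := fun p hp => hcap hp.2
    have hk : ∀ k, ContinuousOn (fun p : ℂ × (Fin (n + 1) → ℝ) => kern k η p.1 p.2)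
        (U ×ˢ capSet n) := fun k =>
      ((continuous_distSq η).pow k).continuousOn.inv₀ fun p hp =>
        pow_ne_zero _ (hd p.1 hp.1 p.2 hp.2)
    have h1 : Continuous (fun p : ℂ × (Fin (n + 1) → ℝ) => (cutoffLap p.2 : ℂ)) :=
      Complex.continuous_ofReal.comp (continuous_cutoffLap.comp continuous_snd)
    have h2 : Continuous (fun p : ℂ × (Fin (n + 1) → ℝ) =>
        ∑ i, (cutoffGrad i p.2 : ℂ) * distSqGrad p.1 i p.2) :=
      continuous_finsetSum _ fun i _ => (Complex.continuous_ofReal.comp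
        ((contDiff_cutoffGrad i).continuous.comp continuous_snd)).mul (continuous_distSqGrad i)
    exact (Complex.continuous_ofReal.comp_continuousOn (hu.comp continuousOn_snd hsnd)).mul
      ((h1.continuousOn.mul (hk a)).sub
        ((continuousOn_const.mul (hk (a + 1))).mul h2.continuousOn))
  · have hk : ∀ k, DifferentiableOn ℂ (fun z => kern k η z y) U := fun k => by
      have : Differentiable ℂ (fun z => distSq η z y ^ k) := by
        unfold distSq; fun_prop
      exact this.differentiableOn.fun_inv fun z hz => pow_ne_zero _ (hd z hz y hy)
    have h2 : Differentiable ℂ (fun z => ∑ i, (cutoffGrad i y : ℂ) * distSqGrad z i y) := by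
      refine Differentiable.fun_sum fun i _ => ?_
      unfold distSqGrad
      split_ifs <;> fun_prop
    exact (((hk a).const_mul _).sub (((hk (a + 1)).const_mul _).mul
      h2.differentiableOn)).const_mul _

lemma norm_capTerm_le {n a : ℕ} {u : (Fin (n + 1) → ℝ) → ℝ} {B η κ : ℝ} {z : ℂ}
    (hB : ∀ y ∈ closedHalf n, |cutoffLap y| ≤ B ∧ ∀ i, |cutoffGrad i y| ≤ B)
    (hu : ∀ y, 0 ≤ y (Fin.last n) → sqNorm y < 4 / 9 → |u y| ≤ 1)
    (hz : ‖z‖ ≤ 1) (hκ : 0 < κ) (hκ1 : κ ≤ 1)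
    (hκd : ∀ y ∈ capSet n, κ ≤ ‖distSq η z y‖) :
    ‖capTerm a u η z‖ ≤
      B * (1 + 8 * a * (n + 1)) * (κ ^ (a + 2))⁻¹ * volume.real (capSet n) := by
  refine norm_setIntegral_le_of_norm_le_const (isCompact_capSet n).measure_lt_top fun y hy => ?_
  rw [norm_mul, Complex.norm_real, Real.norm_eq_abs]
  refine (mul_le_of_le_one_left (norm_nonneg _) (hu y hy.1.1 (closedHalf_subset hy.1).2)).trans ?_
  exact norm_capKern_le (hB y hy.1) hy.1.2 hz hκ hκ1 (hκd y hy)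

lemma exists_norm_tailTerm_le {n a : ℕ} (hn : n = 2 * a + 1) : ∃ C : ℝ, 0 < C ∧
    ∀ (u : (Fin (n + 1) → ℝ) → ℝ) (v : Fin (n + 1) → (Fin (n + 1) → ℝ) → ℝ) (ε : ℝ),
      0 < ε → ε ≤ 1 → HarmonicUpTo u v →
      (∀ y, 0 ≤ y (Fin.last n) → sqNorm y < 4 / 9 → |u y| ≤ 1) →
      (∀ y, y (Fin.last n) = 0 → sqNorm y < 4 / 9 → |u y| ≤ ε ∧ |v (Fin.last n) y| ≤ ε) →
      ∀ t η : ℝ, 0 < t → t < 1 / 3 → 0 < η → η ≤ 1 →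
        ‖tailTerm a u η t‖ ≤
          C * ((ε + η ^ 2) / 2) ^ interpExp + C * ε * ((t ^ 2) ^ (a + 2))⁻¹ := by
  obtain ⟨B, hB0, hB⟩ := exists_cutoff_bound n
  set V₁ := volume.real (capSet n)
  set V₂ := volume.real (Icc (fun _ : Fin n => (-1 : ℝ)) 1)
  set V₃ := volume.real (closedHalf n)
  have hV₁ : 0 ≤ V₁ := measureReal_nonneg
  have hV₂ : 0 ≤ V₂ := measureReal_nonneg
  have hV₃ : 0 ≤ V₃ := measureReal_nonneg
  set C₁ := B * (1 + 8 * a * (n + 1)) * (((1 / 10000 : ℝ)) ^ (a + 2))⁻¹ * V₁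
  set C₂ := (1 + B + 4 * a) * (((1 / 256 : ℝ)) ^ (a + 2))⁻¹ * V₂
  set C₃ := 4 * a * (a + 1) * (((1 / 256 : ℝ)) ^ (a + 2))⁻¹ * V₃
  set C₄ := (1 + B + 4 * a) * V₂
  have hC₁ : 0 ≤ C₁ := by positivity
  have hC₂ : 0 ≤ C₂ := by positivity
  have hC₃ : 0 ≤ C₃ := by positivity
  have hC₄ : 0 ≤ C₄ := by positivity
  set C := 1 + C₁ + 2 * C₂ + 2 * C₃ + C₄
  have hC : 0 < C := by positivity
  refine ⟨C, hC, fun u v ε hε hε1 hu hu1 hflat t η ht ht1 hη hη1 => ?_⟩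
  have hη2 : η ^ 2 ≤ 1 := pow_le_one₀ hη.le hη1
  have hfar : ∀ z : ℂ, ‖z‖ ≤ 257 / 500 → ∀ y ∈ capSet n,
      (257 / 500 - ‖z‖) ^ 2 ≤ ‖distSq η (z - 1 / 8) y‖ := fun z hz y hy =>
    sq_sub_norm_le_norm_distSq hy.1.1
      (by linarith [show 1 / 4 ≤ sqNorm y from hy.2]) hz
  have hnear : ∀ z : ℂ, ‖z‖ ≤ 1 / 16 → ∀ y : Fin (n + 1) → ℝ, 0 ≤ y (Fin.last n) →
      1 / 256 ≤ ‖distSq η (z - 1 / 8) y‖ := fun z hz y hy => by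
    refine le_trans ?_ (sq_sub_norm_le_norm_distSq (r := 1 / 8) hy
      (by linarith [sqNorm_nonneg y]) (hz.trans (by norm_num)))
    nlinarith [norm_nonneg z]
  have hz1 : ∀ z : ℂ, ‖z‖ ≤ 1 / 2 → ‖z - 1 / 8‖ ≤ 1 := fun z hz => by
    refine (norm_sub_le _ _).trans ?_
    norm_num; linarith
  have hdiff : DifferentiableOn ℂ (fun z => capTerm a u η (z - 1 / 8)) (ball 0 (51 / 100)) := by
    have hopen : IsOpen ((fun z : ℂ => z + 1 / 8) ⁻¹' ball 0 (51 / 100)) :=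
      isOpen_ball.preimage (by fun_prop)
    refine (differentiableOn_capTerm a η (hu.cont.mono closedHalf_subset) hopen
      fun z hz y hy => ?_).comp (by fun_prop) fun z hz => by simpa using hz
    have hz' : ‖z + 1 / 8‖ < 51 / 100 := mem_ball_zero_iff.1 hz
    have := hfar (z + 1 / 8) (by linarith) y hy
    rw [add_sub_cancel_right] at this
    rw [← norm_pos_iff]
    refine lt_of_lt_of_le ?_ this
    have : 0 < 257 / 500 - ‖z + 1 / 8‖ := by linarith
    positivity
  have hcap := norm_le_of_norm_le_on_circles (C := C) (e := (ε + η ^ 2) / 2) (r := t + 1 / 8)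
    hdiff hC (by positivity) (by linarith) (fun z hz => ?_) (fun z hz => ?_)
    (by linarith) (by linarith)
  · have hreal : ∀ y : Fin (n + 1) → ℝ,
        ‖distSq η t y‖ = sqNorm (Pi.single (Fin.last n) t - y) + η ^ 2 := fun y => by
      rw [distSq_ofReal, Complex.norm_real, Real.norm_of_nonneg]
      linarith [sqNorm_nonneg (Pi.single (Fin.last n) t - y), sq_nonneg η]
    have hne : ∀ y : Fin (n + 1) → ℝ, 0 ≤ y (Fin.last n) → distSq η t y ≠ 0 := fun y _ => by
      rw [← norm_pos_iff, hreal]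
      linarith [sqNorm_nonneg (Pi.single (Fin.last n) t - y), pow_pos hη 2]
    have hFl := norm_flatTerm_le (a := a) (η := η) (z := t) (κ := t ^ 2) hB hB0.le hε.le hflat
      (by rw [Complex.norm_real, Real.norm_of_nonneg ht.le]; linarith) (by positivity)
      (by nlinarith) fun y hy => by
        have := sq_le_sqNorm (Pi.single (Fin.last n) t - y) (Fin.last n)
        simp only [Pi.sub_apply, Pi.single_eq_same, hy, sub_zero] at this
        rw [hreal]; nlinarith [sq_nonneg η]
    have hid := hu.capTerm_sub_tailTerm (a := a) hn η t hne
    have hcast : ((t + 1 / 8 : ℝ) : ℂ) - 1 / 8 = t := by push_cast; ring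
    rw [hcast] at hcap
    rw [show tailTerm a u η t = capTerm a u η t - flatTerm a u (v (Fin.last n)) η t by
      rw [← hid]; ring]
    refine (norm_sub_le _ _).trans (add_le_add hcap (hFl.trans ?_))
    have : C₄ ≤ C := by linarith
    calc _ = C₄ * ε * ((t ^ 2) ^ (a + 2))⁻¹ := by ring
      _ ≤ _ := by gcongr
  · refine (norm_capTerm_le hB hu1 (hz1 z hz) (κ := 1 / 10000) (by norm_num) (by norm_num)
      fun y hy => ?_).trans (show C₁ ≤ C by linarith)
    refine le_trans ?_ (hfar z (by linarith) y hy)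
    nlinarith
  · have hz2 := hz1 z (hz.trans (by norm_num))
    have hid := hu.capTerm_sub_tailTerm (a := a) hn η (z - 1 / 8) fun y hy => by
      rw [← norm_pos_iff]
      exact lt_of_lt_of_le (by norm_num) (hnear z hz y hy)
    have hFl := norm_flatTerm_le (a := a) (η := η) (κ := 1 / 256) hB hB0.le hε.le hflat hz2
      (by norm_num) (by norm_num) fun y hy => hnear z hz y hy.ge
    have hTl := norm_tailTerm_le (a := a) (η := η) (κ := 1 / 256) hu1
      (by norm_num) (by norm_num) (hnear z hz)
    change ‖capTerm a u η (z - 1 / 8)‖ ≤ _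
    rw [show capTerm a u η (z - 1 / 8) = flatTerm a u (v (Fin.last n)) η (z - 1 / 8) +
      tailTerm a u η (z - 1 / 8) by rw [← hid]; ring]
    refine (norm_add_le _ _).trans ((add_le_add hFl hTl).trans ?_)
    calc _ = C₂ * ε + C₃ * η ^ 2 := by ring
      _ ≤ (2 * C₂ + 2 * C₃) * ((ε + η ^ 2) / 2) := by
        nlinarith [mul_nonneg hC₂ (sq_nonneg η), mul_nonneg hC₃ hε.le]
      _ ≤ C * ((ε + η ^ 2) / 2) := by
        gcongr
        linarith

/-- The profile whose rescalings approximate a point mass in `tailTerm`. -/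
def profile {n : ℕ} (a : ℕ) (x : Fin n → ℝ) : ℝ := ((1 + sqNorm x) ^ (a + 2))⁻¹

lemma profile_pos {n : ℕ} (a : ℕ) (x : Fin n → ℝ) : 0 < profile a x := by
  have := sqNorm_nonneg x
  unfold profile; positivity

lemma norm_sq_le_sqNorm {n : ℕ} (x : Fin n → ℝ) : ‖x‖ ^ 2 ≤ sqNorm x := by
  have h : ‖x‖ ≤ √(sqNorm x) :=
    (pi_norm_le_iff_of_nonneg (Real.sqrt_nonneg _)).2 fun i => by
      rw [Real.norm_eq_abs]
      exact Real.abs_le_sqrt (sq_le_sqNorm x i)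
  exact (pow_le_pow_left₀ (norm_nonneg _) h 2).trans (Real.sq_sqrt (sqNorm_nonneg x)).le

lemma continuous_profile {n : ℕ} (a : ℕ) : Continuous (profile (n := n) a) := by
  refine ((continuous_const.add continuous_sqNorm).pow _).inv₀ fun x => ?_
  have : 0 < 1 + sqNorm x := by linarith [sqNorm_nonneg x]
  exact (pow_pos this _).ne'

lemma integrable_profile {n a : ℕ} (hn : n < 2 * (a + 2)) :
    Integrable (profile (n := n) a) := by
  have h := (integrable_one_add_norm (E := Fin n → ℝ) (μ := volume)
    (r := ((2 * (a + 2) : ℕ) : ℝ)) (by simpa using Nat.cast_lt (α := ℝ).2 hn)).const_mul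
    (2 ^ (a + 2))
  refine h.mono' (continuous_profile a).aestronglyMeasurable (.of_forall fun x => ?_)
  rw [Real.norm_of_nonneg (profile_pos a x).le, Real.rpow_neg (by positivity), Real.rpow_natCast,
    pow_mul, profile, ← div_eq_mul_inv, inv_le_comm₀ (by have := sqNorm_nonneg x; positivity)
      (by positivity), inv_div, div_le_iff₀ (by positivity), ← mul_pow]
  refine pow_le_pow_left₀ (by positivity) ?_ _
  nlinarith [norm_sq_le_sqNorm x, sq_nonneg (‖x‖ - 1)]

lemma integral_profile_pos {n a : ℕ} (hn : n < 2 * (a + 2)) :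
    0 < ∫ x, profile (n := n) a x := by
  refine (integral_pos_iff_support_of_nonneg (fun x => (profile_pos a x).le)
    (integrable_profile hn)).2 ?_
  rw [show Function.support (profile (n := n) a) = univ from
    eq_univ_of_forall fun x => (profile_pos a x).ne']
  exact Measure.measure_univ_pos.2 (NeZero.ne volume)

lemma tendsto_norm_pow_mul_profile {n a : ℕ} (hn : n = 2 * (a + 1)) :
    Filter.Tendsto (fun x : Fin n → ℝ => ‖x‖ ^ n * profile a x)
      (Bornology.cobounded (Fin n → ℝ)) (nhds 0) := by
  have h : Filter.Tendsto (fun x : Fin n → ℝ => (1 + ‖x‖ ^ 2)⁻¹)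
      (Bornology.cobounded (Fin n → ℝ)) (nhds 0) :=
    Filter.Tendsto.inv_tendsto_atTop (Filter.tendsto_atTop_add_const_left _ _
      ((Filter.tendsto_pow_atTop two_ne_zero).comp tendsto_norm_cobounded_atTop))
  refine squeeze_zero (fun x => mul_nonneg (by positivity) (profile_pos a x).le) (fun x => ?_) h
  have hS := sqNorm_nonneg x
  have hle := norm_sq_le_sqNorm x
  rw [profile, show ‖x‖ ^ n = (‖x‖ ^ 2) ^ (a + 1) by rw [← pow_mul, ← hn],
    ← div_eq_mul_inv, div_le_iff₀ (by positivity), inv_mul_eq_div, le_div_iff₀ (by positivity)]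
  calc (‖x‖ ^ 2) ^ (a + 1) * (1 + ‖x‖ ^ 2)
      ≤ (1 + sqNorm x) ^ (a + 1) * (1 + sqNorm x) := by gcongr; linarith
    _ = _ := by ring

lemma sqNorm_smul {n : ℕ} (c : ℝ) (x : Fin n → ℝ) : sqNorm (c • x) = c ^ 2 * sqNorm x := by
  simp [sqNorm, Finset.mul_sum, mul_pow]

lemma sqNorm_single {n : ℕ} (i : Fin n) (t : ℝ) : sqNorm (Pi.single i t) = t ^ 2 := by
  rw [sqNorm, Finset.sum_eq_single i (fun j _ hj => by simp [hj]) (by simp)]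
  simp

/-- As the mollification parameter tends to `0`, `tailTerm` converges to a point evaluation. -/
lemma tendsto_tailTerm {n a : ℕ} (hn : n = 2 * a + 1) {u : (Fin (n + 1) → ℝ) → ℝ}
    (hu : ContinuousOn u {y | 0 ≤ y (Fin.last n) ∧ sqNorm y < 4 / 9}) {t : ℝ}
    (ht : 0 < t) (ht1 : t < 1 / 3) :
    Filter.Tendsto (fun c : ℝ => tailTerm a u c⁻¹ t) Filter.atTop
      (nhds ((4 * a * (a + 1) * (∫ x, profile (n := n + 1) a x) *
        u (Pi.single (Fin.last n) t) : ℝ) : ℂ)) := by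
  have hlt : n + 1 < 2 * (a + 2) := by omega
  set c₀ := ∫ x, profile (n := n + 1) a x
  have hc₀ : 0 < c₀ := integral_profile_pos hlt
  set x₀ : Fin (n + 1) → ℝ := Pi.single (Fin.last n) t
  have hx₀ : x₀ (Fin.last n) = t := Pi.single_eq_same _ _
  have hx₀S : sqNorm x₀ < 1 / 4 := by rw [sqNorm_single]; nlinarith
  set g : (Fin (n + 1) → ℝ) → ℝ := (closedHalf n).indicator fun y => u y * cutoff y
  have hnhds : closedHalf n ∈ nhds x₀ := by
    filter_upwards [(isOpen_lt continuous_const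
      (continuous_apply (A := fun _ => ℝ) (Fin.last n))).mem_nhds
      (show (0 : ℝ) < x₀ (Fin.last n) by rwa [hx₀]),
      (isOpen_lt continuous_sqNorm continuous_const).mem_nhds hx₀S] with y hy hy'
    exact ⟨le_of_lt hy, by linarith [show sqNorm y < 1 / 4 from hy']⟩
  have hcont : ContinuousOn (fun y => u y * cutoff y) (closedHalf n) :=
    (hu.mono closedHalf_subset).mul contDiff_cutoff.continuous.continuousOn
  have hg : Integrable g := (integrable_indicator_iff (isClosed_closedHalf n).measurableSet).2
    (hcont.integrableOn_compact (isCompact_closedHalf n))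
  have hgx : ContinuousAt g x₀ :=
    (hcont.continuousAt hnhds).congr (by
      filter_upwards [hnhds] with y hy
      exact (indicator_of_mem hy (fun y => u y * cutoff y)).symm)
  have hgx₀ : g x₀ = u x₀ := by
    rw [show g x₀ = u x₀ * cutoff x₀ from
      indicator_of_mem (mem_of_mem_nhds hnhds) (fun y => u y * cutoff y),
      cutoff_eq_one hx₀S.le, mul_one]
  have key := tendsto_integral_comp_smul_smul_of_integrable' (μ := volume)
    (φ := fun x : Fin (n + 1) → ℝ => c₀⁻¹ * profile a x)
    (fun x => mul_nonneg (inv_nonneg.2 hc₀.le) (profile_pos a x).le)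
    (by rw [integral_const_mul]; exact inv_mul_cancel₀ hc₀.ne')
    (by
      have := (tendsto_norm_pow_mul_profile (a := a) (n := n + 1) (by omega)).const_mul c₀⁻¹
      rw [mul_zero] at this
      refine this.congr fun x => ?_
      rw [Module.finrank_fin_fun]; ring) hg hgx
  rw [hgx₀] at key
  have key' := (Complex.continuous_ofReal.tendsto _).comp (key.const_mul (4 * a * (a + 1) * c₀))
  refine key'.congr' ?_
  filter_upwards [Filter.eventually_gt_atTop 0] with c hc
  have hg' : ∀ y, (c ^ Module.finrank ℝ (Fin (n + 1) → ℝ) *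
      (c₀⁻¹ * profile a (c • (x₀ - y)))) • g y = (closedHalf n).indicator (fun y =>
        (c ^ (n + 1) * (c₀⁻¹ * profile a (c • (x₀ - y)))) * (u y * cutoff y)) y := fun y => by
    rw [Module.finrank_fin_fun, smul_eq_mul]
    by_cases hy : y ∈ closedHalf n
    · simp [g, hy]
    · simp [g, hy]
  simp only [Function.comp_apply, hg']
  rw [integral_indicator (isClosed_closedHalf n).measurableSet, ← integral_const_mul,
    ← integral_complex_ofReal, tailTerm]
  refine integral_congr_ae (.of_forall fun y => ?_)
  have hS := sqNorm_nonneg (x₀ - y)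
  have hprof : c ^ (n + 1) * profile a (c • (x₀ - y)) =
      c⁻¹ ^ 2 * ((sqNorm (x₀ - y) + c⁻¹ ^ 2) ^ (a + 2))⁻¹ := by
    rw [profile, sqNorm_smul, show 1 + c ^ 2 * sqNorm (x₀ - y) =
      c ^ 2 * (sqNorm (x₀ - y) + c⁻¹ ^ 2) by field_simp; ring,
      show c ^ (n + 1) = (c ^ 2) ^ (a + 1) by rw [← pow_mul, hn]; ring_nf, mul_pow]
    have : 0 < sqNorm (x₀ - y) + c⁻¹ ^ 2 := by positivity
    field_simp
    ring
  dsimp only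
  rw [kern, distSq_ofReal]
  have : 4 * a * (a + 1) * c₀ * (c ^ (n + 1) * (c₀⁻¹ * profile a (c • (x₀ - y))) *
      (u y * cutoff y)) = u y * (cutoff y * (4 * a * (a + 1) * c⁻¹ ^ 2 *
        ((sqNorm (x₀ - y) + c⁻¹ ^ 2) ^ (a + 2))⁻¹)) := by
    linear_combination (4 * a * (a + 1) * u y * cutoff y) * hprof +
      (4 * a * (a + 1) * u y * cutoff y) * (c ^ (n + 1) * profile a (c • (x₀ - y))) *
      mul_inv_cancel₀ hc₀.ne'
  rw [this]
  push_cast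
  rfl

/-- A harmonic function with small Cauchy data on the flat part of the boundary is small on the
symmetry axis of the half-ball. -/
lemma exists_abs_le_rpow_on_axis {n a : ℕ} (hn : n = 2 * a + 1) (ha : 0 < a) :
    ∃ γ ∈ Ioo (0 : ℝ) 1, ∃ C : ℝ, 0 < C ∧
    ∀ (u : (Fin (n + 1) → ℝ) → ℝ) (v : Fin (n + 1) → (Fin (n + 1) → ℝ) → ℝ) (ε : ℝ),
      0 < ε → ε ≤ 1 → HarmonicUpTo u v →
      (∀ y, 0 ≤ y (Fin.last n) → sqNorm y < 4 / 9 → |u y| ≤ 1) →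
      (∀ y, 0 < y (Fin.last n) → sqNorm y < 4 / 9 → |v (Fin.last n) y| ≤ 1) →
      (∀ y, y (Fin.last n) = 0 → sqNorm y < 4 / 9 → |u y| ≤ ε ∧ |v (Fin.last n) y| ≤ ε) →
      ∀ t : ℝ, 0 < t → t < 1 / 3 → |u (Pi.single (Fin.last n) t)| ≤ C * ε ^ γ := by
  obtain ⟨C, hC, hmain⟩ := exists_norm_tailTerm_le hn
  set c₁ : ℝ := 4 * a * (a + 1) * ∫ x, profile (n := n + 1) a x
  have hc₁ : 0 < c₁ := by
    have : 0 < ∫ x, profile (n := n + 1) a x := integral_profile_pos (by omega)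
    have : (0 : ℝ) < a := by exact_mod_cast ha
    positivity
  set β : ℝ := 1 / (4 * (a + 2)) with hβ
  have hβ0 : 0 < β := by positivity
  obtain ⟨hθ0, hθ1⟩ := interpExp_mem
  set γ : ℝ := min interpExp (min (1 / 2) β)
  have hγ0 : 0 < γ := lt_min hθ0 (lt_min (by norm_num) hβ0)
  have hγ1 : γ < 1 := (min_le_left _ _).trans_lt hθ1
  refine ⟨γ, ⟨hγ0, hγ1⟩, 2 + 2 * C / c₁, by positivity,
    fun u v ε hε hε1 hu hu1 hv1 hflat t ht ht1 => ?_⟩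
  have hγle : ∀ {b : ℝ}, γ ≤ b → ε ^ b ≤ ε ^ γ := fun hb =>
    Real.rpow_le_rpow_of_exponent_ge hε hε1 hb
  have hεγ : 0 < ε ^ γ := Real.rpow_pos_of_pos hε _
  have hCc : 0 < 2 * C / c₁ := by positivity
  rcases lt_or_ge t (ε ^ β) with htβ | htβ
  · set f : ℝ → ℝ := fun s => u (Pi.single (Fin.last n) s)
    have hmem : ∀ s ∈ Icc 0 t, Pi.single (Fin.last n) s ∈
        {y : Fin (n + 1) → ℝ | 0 ≤ y (Fin.last n) ∧ sqNorm y < 4 / 9} := fun s hs => by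
      refine ⟨by simpa using hs.1, ?_⟩
      rw [sqNorm_single]; nlinarith [hs.1, hs.2]
    have hf : ContinuousOn f (Icc 0 t) :=
      hu.cont.comp (fun s _ =>
        (hasDerivAt_single (Fin.last n) s).continuousAt.continuousWithinAt) hmem
    have hf' : ∀ s ∈ Ioo 0 t, HasDerivAt f (v (Fin.last n) (Pi.single (Fin.last n) s)) s :=
      fun s hs => by
        obtain ⟨L, hL, hLi⟩ := hu.hasFDerivAt (Pi.single (Fin.last n) s) (by simpa using hs.1)
          (hmem s (Ioo_subset_Icc_self hs)).2
        have h := hL.comp_hasDerivAt s (hasDerivAt_single (Fin.last n) s)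
        rwa [hLi] at h
    obtain ⟨s, hs, hst⟩ := exists_hasDerivAt_eq_slope f _ ht hf hf'
    have hvs := hv1 (Pi.single (Fin.last n) s) (by simpa using hs.1)
      (hmem s (Ioo_subset_Icc_self hs)).2
    have h0 : |f 0| ≤ ε := (hflat _ (by simp) (by rw [sqNorm_single]; norm_num)).1
    rw [sub_zero, eq_div_iff ht.ne'] at hst
    have hft : f t = f 0 + v (Fin.last n) (Pi.single (Fin.last n) s) * t := by linarith
    have h1 : |f t| ≤ ε + t := by
      rw [hft]
      refine (abs_add_le _ _).trans (add_le_add h0 ?_)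
      rw [abs_mul, abs_of_pos ht]
      exact mul_le_of_le_one_left ht.le hvs
    have h2 : ε ≤ ε ^ γ := by simpa using hγle hγ1.le
    have h3 : ε ^ β ≤ ε ^ γ := hγle ((min_le_right _ _).trans (min_le_right _ _))
    calc |f t| ≤ 2 * ε ^ γ := by linarith
      _ ≤ _ := by gcongr; linarith
  · have hlim := (tendsto_tailTerm hn hu.cont ht ht1).norm
    have hη : Filter.Tendsto (fun c : ℝ => C * ((ε + c⁻¹ ^ 2) / 2) ^ interpExp +
        C * ε * ((t ^ 2) ^ (a + 2))⁻¹) Filter.atTop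
        (nhds (C * ((ε + 0 ^ 2) / 2) ^ interpExp + C * ε * ((t ^ 2) ^ (a + 2))⁻¹)) := by
      refine Filter.Tendsto.add_const _ (Filter.Tendsto.const_mul _
        (Filter.Tendsto.rpow_const ?_ (Or.inr hθ0.le)))
      exact ((tendsto_inv_atTop_zero.pow 2).const_add ε).div_const 2
    have hle := le_of_tendsto_of_tendsto hlim hη (by
      filter_upwards [Filter.eventually_ge_atTop 1] with c hc
      exact hmain u v ε hε hε1 hu hu1 hflat t c⁻¹ ht ht1 (by positivity) (inv_le_one_of_one_le₀ hc))
    rw [Complex.norm_real, Real.norm_eq_abs, abs_mul, abs_of_pos hc₁] at hle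
    have h1 : ((ε + 0 ^ 2) / 2) ^ interpExp ≤ ε ^ γ :=
      (Real.rpow_le_rpow (by positivity) (by linarith) hθ0.le).trans (hγle (min_le_left _ _))
    have h2 : ε * ((t ^ 2) ^ (a + 2))⁻¹ ≤ ε ^ γ := by
      refine le_trans ?_ (hγle ((min_le_right _ _).trans (min_le_left (1 / 2 : ℝ) β)))
      have h3 : ε ^ (1 / 2 : ℝ) ≤ (t ^ 2) ^ (a + 2) := by
        rw [← pow_mul]
        refine le_trans (le_of_eq ?_) (pow_le_pow_left₀ (by positivity) htβ _)
        rw [← Real.rpow_natCast, ← Real.rpow_mul hε.le]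
        congr 1
        rw [hβ]; push_cast; field_simp; norm_num
      have h4 : ε = ε ^ (1 / 2 : ℝ) * ε ^ (1 / 2 : ℝ) := by
        rw [← Real.rpow_add hε]; norm_num
      rw [← div_eq_mul_inv, div_le_iff₀ (by positivity)]
      nth_rw 1 [h4]
      gcongr
    have h5 : c₁ * |u (Pi.single (Fin.last n) t)| ≤ 2 * C * ε ^ γ := by
      refine hle.trans ?_
      calc _ ≤ C * ε ^ γ + C * ε ^ γ := by
            rw [mul_assoc C ε]
            gcongr
        _ = _ := by ring
    calc |u (Pi.single (Fin.last n) t)| ≤ 2 * C / c₁ * ε ^ γ := by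
          rw [div_mul_eq_mul_div, le_div_iff₀ hc₁]; linarith
      _ ≤ _ := by gcongr; linarith

lemma continuous_lastC (m : ℕ) : Continuous (lastC (m := m)) := by
  unfold lastC; fun_prop

lemma isOpen_halfBall (m : ℕ) (c : ℝ) : IsOpen (halfBall m c) :=
  (isOpen_lt continuous_norm continuous_const).inter
    (isOpen_lt continuous_const (continuous_lastC m))

lemma mem_closure_halfBall {m : ℕ} {y : Euc m} (hy : ‖y‖ < 1) (hy0 : 0 ≤ lastC y) :
    y ∈ closure (halfBall m 1) := by
  have hc : Continuous fun s : ℝ => y + s • eLast m := by fun_prop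
  have h0 : Filter.Tendsto (fun s : ℝ => y + s • eLast m) (nhdsWithin 0 (Ioi 0)) (nhds y) := by
    simpa using (hc.tendsto 0).mono_left nhdsWithin_le_nhds
  refine mem_closure_of_tendsto h0 ?_
  filter_upwards [self_mem_nhdsWithin, h0.eventually
    ((isOpen_lt continuous_norm continuous_const).mem_nhds hy)] with s hs hs'
  refine ⟨hs', ?_⟩
  have : lastC (y + s • eLast m) = lastC y + s := by simp [lastC, eLast]
  rw [this]
  exact add_pos_of_nonneg_of_pos hy0 hs

/-- The projection onto the last `m + 1` coordinates. -/
def lastCoords (k m : ℕ) : (Fin (k + m + 1) → ℝ) →L[ℝ] Euc m :=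
  (EuclideanSpace.equiv (Fin (m + 1)) ℝ).symm.toContinuousLinearMap.comp
    (ContinuousLinearMap.pi fun j => ContinuousLinearMap.proj (R := ℝ) (φ := fun _ => ℝ)
      (Fin.natAdd k j : Fin (k + (m + 1))))

lemma lastCoords_apply {k m : ℕ} (y : Fin (k + m + 1) → ℝ) (j : Fin (m + 1)) :
    lastCoords k m y j = y (Fin.natAdd k j : Fin (k + (m + 1))) := rfl

lemma lastC_lastCoords {k m : ℕ} (y : Fin (k + m + 1) → ℝ) :
    lastC (lastCoords k m y) = y (Fin.last (k + m)) := rfl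

lemma norm_lastCoords_sq_le {k m : ℕ} (y : Fin (k + m + 1) → ℝ) :
    ‖lastCoords k m y‖ ^ 2 ≤ sqNorm y := by
  rw [EuclideanSpace.real_norm_sq_eq]
  change _ ≤ ∑ i : Fin (k + (m + 1)), y i ^ 2
  rw [Fin.sum_univ_add (fun i : Fin (k + (m + 1)) => y i ^ 2)]
  exact le_add_of_nonneg_left (a := ∑ j : Fin (m + 1), y (Fin.natAdd k j) ^ 2)
    (Finset.sum_nonneg fun _ _ => sq_nonneg _)

lemma lastCoords_single_castAdd {k m : ℕ} (i : Fin k) :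
    lastCoords k m (Pi.single (Fin.castAdd (m + 1) i) 1) = 0 := by
  ext j
  rw [lastCoords_apply, Pi.single_eq_of_ne]
  · rfl
  · intro h
    have := congrArg Fin.val h
    simp at this
    omega

lemma lastCoords_single_natAdd {k m : ℕ} (j : Fin (m + 1)) :
    lastCoords k m (Pi.single (Fin.natAdd k j : Fin (k + (m + 1))) 1) =
      EuclideanSpace.single j 1 := by
  ext i
  rw [lastCoords_apply, PiLp.single_apply, Pi.single_apply]
  simp [Fin.ext_iff]

lemma lastCoords_single_last {k m : ℕ} (t : ℝ) :
    lastCoords k m (Pi.single (Fin.last (k + m)) t) = t • eLast m := by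
  have h : (Pi.single (Fin.last (k + m)) t : Fin (k + m + 1) → ℝ) =
      t • Pi.single (Fin.natAdd k (Fin.last m) : Fin (k + (m + 1))) 1 := by
    rw [← Pi.single_smul]; simp
  rw [h, map_smul, lastCoords_single_natAdd]
  rfl

lemma lastC_add {m : ℕ} (x y : Euc m) : lastC (x + y) = lastC x + lastC y := rfl

lemma norm_add_lastCoords_lt {k m : ℕ} {p : Euc m} {y : Fin (k + m + 1) → ℝ} (hp : ‖p‖ ≤ 1 / 3)
    (hy : sqNorm y < 4 / 9) : ‖p + lastCoords k m y‖ < 1 := by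
  have h : ‖lastCoords k m y‖ < 2 / 3 :=
    lt_of_pow_lt_pow_left₀ 2 (by norm_num)
      ((norm_lastCoords_sq_le y).trans_lt (hy.trans_eq (by norm_num)))
  linarith [norm_add_le p (lastCoords k m y)]

/-- Composing with a translate of `lastCoords` turns a harmonic function on the unit half-ball
into a function that is harmonic in more variables. -/
lemma harmonicUpTo_comp_lastCoords {k m : ℕ} {h : Euc m → ℝ} {h' : Euc m → Euc m →L[ℝ] ℝ}
    {p : Euc m} (hp : ‖p‖ ≤ 1 / 3) (hp0 : lastC p = 0) (hh : IsHarmonicOn h (halfBall m 1))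
    (hd : ∀ x ∈ closure (halfBall m 1), HasFDerivWithinAt h (h' x) (closure (halfBall m 1)) x)
    (hc : ContinuousOn h' (closure (halfBall m 1))) :
    HarmonicUpTo (fun y => h (p + lastCoords k m y))
      (fun i y => h' (p + lastCoords k m y) (lastCoords k m (Pi.single i 1))) := by
  set S := halfBall m 1
  have hSo : IsOpen S := isOpen_halfBall m 1
  set A : (Fin (k + m + 1) → ℝ) → Euc m := fun y => p + lastCoords k m y
  have hA : ∀ y, HasFDerivAt A (lastCoords k m) y := fun y =>
    (lastCoords k m).hasFDerivAt.const_add p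
  have hAlast : ∀ y, lastC (A y) = y (Fin.last (k + m)) := fun y => by
    rw [lastC_add, hp0, zero_add, lastC_lastCoords]
  have hAS : ∀ y, 0 < y (Fin.last (k + m)) → sqNorm y < 4 / 9 → A y ∈ S := fun y hy hy' =>
    ⟨norm_add_lastCoords_lt hp hy', by rwa [hAlast]⟩
  have hAK : MapsTo A {y | 0 ≤ y (Fin.last (k + m)) ∧ sqNorm y < 4 / 9} (closure S) :=
    fun y hy => mem_closure_halfBall (norm_add_lastCoords_lt hp hy.2) (by rw [hAlast]; exact hy.1)
  have hAc : Continuous A := continuous_const.add (lastCoords k m).continuous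
  have hdS : ∀ x ∈ S, HasFDerivAt h (h' x) x := fun x hx =>
    (hd x (subset_closure hx)).hasFDerivAt (Filter.mem_of_superset (hSo.mem_nhds hx) subset_closure)
  have hd2 : ∀ x ∈ S, HasFDerivAt h' (fderiv ℝ (fderiv ℝ h) x) x := fun x hx => by
    have h1 : ContDiffAt ℝ 1 (fderiv ℝ h) x :=
      (hh.1.contDiffAt (hSo.mem_nhds hx)).fderiv_right (by norm_num)
    refine (h1.differentiableAt one_ne_zero).hasFDerivAt.congr_of_eventuallyEq ?_
    filter_upwards [hSo.mem_nhds hx] with z hz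
    exact (hdS z hz).fderiv.symm
  refine ⟨fun y hy hy' => ⟨_, (hdS _ (hAS y hy hy')).comp y (hA y), fun i => rfl⟩,
    fun y hy hy' => ?_, fun y hy => ?_, fun i => ?_⟩
  · have hD := fun w => (((hd2 _ (hAS y hy hy')).comp y (hA y)).clm_apply (hasFDerivAt_const w y))
    refine ⟨_, fun i => hD (lastCoords k m (Pi.single i 1)), ?_⟩
    have hlap := hh.2 _ (hAS y hy hy')
    simp only [lap, iteratedFDeriv_two_apply, Matrix.cons_val_zero, Matrix.cons_val_one] at hlap
    change ∑ i : Fin (k + (m + 1)), _ = (0 : ℝ)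
    rw [Fin.sum_univ_add]
    simpa [lastCoords_single_castAdd, lastCoords_single_natAdd] using hlap
  · exact (hd _ (hAK hy)).continuousWithinAt.comp hAc.continuousWithinAt hAK
  · exact (hc.comp hAc.continuousOn hAK).clm_apply continuousOn_const

/-- Quantitative Cauchy uniqueness, for harmonic functions with nonzero Cauchy data. -/
lemma exists_abs_le_rpow_of_pos (m : ℕ) :
    ∃ γ ∈ Ioo (0 : ℝ) 1, ∃ C : ℝ, 0 < C ∧
      ∀ (h : Euc m → ℝ) (h' : Euc m → Euc m →L[ℝ] ℝ) (ε : ℝ), 0 < ε → ε ≤ 1 →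
        IsHarmonicOn h (halfBall m 1) →
        (∀ x ∈ closure (halfBall m 1), HasFDerivWithinAt h (h' x) (closure (halfBall m 1)) x) →
        ContinuousOn h' (closure (halfBall m 1)) →
        (∀ x ∈ halfBall m 1, |h x| ≤ 1) →
        (∀ x ∈ halfBall m 1, ‖h' x‖ ≤ 1) →
        (∀ x ∈ flatPart m, |h x| ≤ ε) →
        (∀ x ∈ flatPart m, |h' x (eLast m)| ≤ ε) →
        ∀ x ∈ halfBall m (1 / 3), |h x| ≤ C * ε ^ γ := by
  obtain ⟨γ, hγ, C, hC, hmain⟩ := exists_abs_le_rpow_on_axis (n := m + 3 + m) (a := m + 1)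
    (by omega) (by omega)
  refine ⟨γ, hγ, C, hC, fun h h' ε hε hε1 hh hd hc h1 h1' hf hf' x hx => ?_⟩
  set t := lastC x
  have ht : 0 < t := hx.2
  have ht1 : t < 1 / 3 :=
    ((le_abs_self _).trans (show |t| ≤ ‖x‖ from PiLp.norm_apply_le x (Fin.last m))).trans_lt hx.1
  set p : Euc m := x - t • eLast m
  have hp0 : lastC p = 0 := by simp [p, lastC, eLast, t]
  have hp : ‖p‖ ≤ 1 / 3 := by
    refine le_trans ?_ hx.1.le
    refine le_of_sq_le_sq ?_ (norm_nonneg _)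
    rw [EuclideanSpace.real_norm_sq_eq, EuclideanSpace.real_norm_sq_eq]
    refine Finset.sum_le_sum fun i _ => ?_
    by_cases hi : i = Fin.last m
    · subst hi
      rw [show p (Fin.last m) = 0 from hp0]
      simpa using sq_nonneg (x (Fin.last m))
    · simp [p, eLast, hi]
  have hlast : lastCoords (m + 3) m (Pi.single (Fin.last (m + 3 + m)) 1) = eLast m := by
    rw [lastCoords_single_last, one_smul]
  have hAlast : ∀ y, lastC (p + lastCoords (m + 3) m y) = y (Fin.last (m + 3 + m)) := fun y => by
    rw [lastC_add, hp0, zero_add, lastC_lastCoords]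
  have hin : ∀ y, 0 < y (Fin.last (m + 3 + m)) → sqNorm y < 4 / 9 →
      p + lastCoords (m + 3) m y ∈ halfBall m 1 := fun y hy hy' =>
    ⟨norm_add_lastCoords_lt hp hy', by rwa [hAlast]⟩
  have hfl : ∀ y, y (Fin.last (m + 3 + m)) = 0 → sqNorm y < 4 / 9 →
      p + lastCoords (m + 3) m y ∈ flatPart m := fun y hy hy' =>
    ⟨mem_closure_halfBall (norm_add_lastCoords_lt hp hy') (by rw [hAlast, hy]),
      by rw [hAlast, hy]⟩
  have key := hmain _ _ ε hε hε1 (harmonicUpTo_comp_lastCoords (k := m + 3) hp hp0 hh hd hc)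
    (fun y hy hy' => ?_) (fun y hy hy' => ?_) (fun y hy hy' => ⟨hf _ (hfl y hy hy'), ?_⟩) t ht ht1
  · simpa only [lastCoords_single_last, p, sub_add_cancel] using key
  · rcases hy.eq_or_lt with hy0 | hy0
    · exact (hf _ (hfl y hy0.symm hy')).trans hε1
    · exact h1 _ (hin y hy0 hy')
  · rw [hlast]
    refine ((h' _).le_opNorm _).trans ?_
    simpa [eLast] using h1' _ (hin y hy hy')
  · rw [hlast]
    exact hf' _ (hfl y hy hy')

/-- (Quantitative Cauchy uniqueness, Lemma 2.2.) There exist `γ ∈ (0,1)`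
and `C > 0` (depending only on the dimension `d = m+1`) such that: if `h` is harmonic in the
unit half-ball `B₊`, is `C¹` on its closure (with derivative `h'`), satisfies `|h| ≤ 1`,
`‖∇h‖ ≤ 1` on `B₊` and `|h| ≤ ε`, `|∂_d h| ≤ ε` on the flat part `Γ` of the boundary with
`ε ≤ 1`, then `|h| ≤ C ε^γ` on `(1/3)B₊`. -/
theorem stmt_4 (m : ℕ) :
    ∃ γ ∈ Set.Ioo (0 : ℝ) 1, ∃ C : ℝ, 0 < C ∧
      ∀ (h : Euc m → ℝ) (h' : Euc m → Euc m →L[ℝ] ℝ) (ε : ℝ), ε ≤ 1 →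
        IsHarmonicOn h (halfBall m 1) →
        (∀ x ∈ closure (halfBall m 1), HasFDerivWithinAt h (h' x) (closure (halfBall m 1)) x) →
        ContinuousOn h' (closure (halfBall m 1)) →
        (∀ x ∈ halfBall m 1, |h x| ≤ 1) →
        (∀ x ∈ halfBall m 1, ‖h' x‖ ≤ 1) →
        (∀ x ∈ flatPart m, |h x| ≤ ε) →
        (∀ x ∈ flatPart m, |h' x (eLast m)| ≤ ε) →
        ∀ x ∈ halfBall m (1 / 3), |h x| ≤ C * ε ^ γ := by
  obtain ⟨γ, hγ, C, hC, hmain⟩ := exists_abs_le_rpow_of_pos m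
  refine ⟨γ, hγ, C, hC, fun h h' ε hε1 hh hd hc h1 h1' hf hf' x hx => ?_⟩
  have hε : 0 ≤ ε := (abs_nonneg _).trans (hf 0 ⟨mem_closure_halfBall (by simp) le_rfl, rfl⟩)
  rcases hε.eq_or_lt with rfl | hε0
  · have hlim : Filter.Tendsto (fun ε : ℝ => C * ε ^ γ) (nhdsWithin 0 (Ioi 0))
        (nhds (C * 0 ^ γ)) :=
      (((Real.continuousAt_rpow_const 0 γ (Or.inr hγ.1.le)).tendsto).mono_left
        nhdsWithin_le_nhds).const_mul C
    refine ge_of_tendsto hlim ?_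
    filter_upwards [Ioc_mem_nhdsGT one_pos] with δ hδ
    exact hmain h h' δ hδ.1 hδ.2 hh hd hc h1 h1' (fun y hy => (hf y hy).trans hδ.1.le)
      (fun y hy => (hf' y hy).trans hδ.1.le) x hx
  · exact hmain h h' ε hε0 hε1 hh hd hc h1 h1' hf hf' x hx
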